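/- arXiv:math/0612348 — 3 statements merged into one kernel-verified Lean document; each statement's English description precedes it below -/
import Mathlib

section
/- As X → ∞, ∑_{n X-smooth} β_1(n)/n ~ ζ(2)/(e^γ log X), where β_1 is multiplicative with β_1(p) = -(1+1/p)^{-1}, β_1(p^j)=0 (j≥2) for p ≤ √X, and β_1(p) = -(1+1/(2p))^{-1}, β_1(p²) = (2(1+1/(2p)))^{-1}, β_1(p^j)=0 (j≥3) for √X < p ≤ X. -/
open Real Filter

noncomputable def pc (n : ℕ) : ℝ := if n.Prime then 1 / (n : ℝ) else 0

lemma pc_nonneg (n : ℕ) : 0 ≤ pc n := by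
  unfold pc; split_ifs <;> positivity

lemma log_factorial_eq (N : ℕ) : Real.log (N.factorial : ℝ) =
    ∑ p ∈ (Finset.range (N+1)).filter Nat.Prime, (N.factorial.factorization p : ℝ) * Real.log p := by
  rw [Real.log_nat_eq_sum_factorization, Finsupp.sum]
  apply Finset.sum_subset
  · intro p hp
    rw [Nat.support_factorization, Nat.mem_primeFactors] at hp
    simp only [Finset.mem_filter, Finset.mem_range]
    exact ⟨by have := hp.1.dvd_factorial.1 hp.2.1; omega, hp.1⟩
  · intro p _ hp
    simp only [Finsupp.mem_support_iff, not_not] at hp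
    simp [hp]

lemma vp_lower {p N : ℕ} (hp : p.Prime) :
    (N : ℝ) * (1 / p) - 1 ≤ (N.factorial.factorization p : ℝ) := by
  rw [Nat.factorization_factorial hp (b := Nat.log p N + 2) (by omega)]
  have h1 : N / p ^ 1 ≤ ∑ i ∈ Finset.Ico 1 (Nat.log p N + 2), N / p ^ i :=
    Finset.single_le_sum (f := fun i => N / p ^ i) (fun _ _ => Nat.zero_le _)
      (by simp)
  have h2 : (N : ℝ) / p < (N / p : ℕ) + 1 := by
    have := Nat.lt_floor_add_one ((N : ℝ) / p)
    rwa [Nat.floor_div_eq_div] at this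
  rw [pow_one] at h1
  have h3 : ((N / p : ℕ) : ℝ) ≤ ((∑ i ∈ Finset.Ico 1 (Nat.log p N + 2), N / p ^ i : ℕ) : ℝ) := by
    exact_mod_cast h1
  rw [mul_one_div]
  linarith

lemma vp_upper {p N : ℕ} (hp : p.Prime) :
    (N.factorial.factorization p : ℝ) ≤ N * (1 / p + 1 / (p * (p - 1))) := by
  have := Fact.mk hp
  have h := sub_one_mul_padicValNat_factorial (p := p) N
  have h1 : (p - 1) * padicValNat p N.factorial ≤ N := by omega
  rw [Nat.factorization_def _ hp]
  have h2 : ((p : ℝ) - 1) * (padicValNat p N.factorial : ℝ) ≤ N := by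
    have : ((p - 1 : ℕ) : ℝ) = (p : ℝ) - 1 := by
      rw [Nat.cast_sub hp.one_le]; simp
    rw [← this]; exact_mod_cast h1
  have hp1 : (0 : ℝ) < (p : ℝ) - 1 := by
    have : (1 : ℝ) < p := by exact_mod_cast hp.one_lt
    linarith
  have hp0 : (0 : ℝ) < p := by linarith
  have : (1 : ℝ) / p + 1 / (p * (p - 1)) = 1 / (p - 1) := by
    field_simp; ring
  rw [this, mul_one_div, le_div_iff₀ hp1]
  linarith

lemma log_bound {p : ℕ} (hp : 2 ≤ p) :
    (1 : ℝ) / (p * (p - 1)) * Real.log p ≤ 4 * (1 / (p : ℝ) ^ (3/2 : ℝ)) := by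
  have hp2 : (2 : ℝ) ≤ p := by exact_mod_cast hp
  have h1 := Real.log_le_rpow_div (x := p) (ε := 1/2) (by positivity) (by norm_num)
  have h2 : (p : ℝ) ^ (3/2 : ℝ) * (p : ℝ) ^ (1/2 : ℝ) = p ^ 2 := by
    rw [← Real.rpow_add (by positivity)]; norm_num
  have h3 : (1 : ℝ) / (p * (p - 1)) ≤ 2 / p ^ 2 := by
    rw [div_le_div_iff₀ (by nlinarith) (by positivity)]
    nlinarith
  have hpos : 0 < (p : ℝ) ^ (3/2 : ℝ) := by positivity
  have hlog : 0 ≤ Real.log p := Real.log_nonneg (by linarith)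
  calc _ ≤ 2 / (p : ℝ) ^ 2 * ((p : ℝ) ^ (1/2 : ℝ) / (1/2)) := by gcongr
    _ = _ := by rw [← h2]; field_simp; ring

lemma mertens_one : ∃ K : ℝ, ∀ N : ℕ, 1 ≤ N →
    |∑ n ∈ Finset.range (N+1), pc n * Real.log n - Real.log N| ≤ K := by
  have hs : Summable (fun n : ℕ => 4 * (1 / (n : ℝ) ^ (3/2 : ℝ))) :=
    (Real.summable_one_div_nat_rpow.2 (by norm_num)).mul_left 4
  set K1 := ∑' n : ℕ, 4 * (1 / (n : ℝ) ^ (3/2 : ℝ)) with hK1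
  have hK1pos : 0 ≤ K1 := tsum_nonneg fun n => by positivity
  have hl4 : 0 ≤ Real.log 4 := Real.log_nonneg (by norm_num)
  refine ⟨1 + K1 + Real.log 4, fun N hN => ?_⟩
  have hN0 : (0 : ℝ) < N := by exact_mod_cast hN
  have hsum : ∑ n ∈ Finset.range (N+1), pc n * Real.log n =
      ∑ p ∈ (Finset.range (N+1)).filter Nat.Prime, (1 / (p : ℝ)) * Real.log p := by
    rw [Finset.sum_filter]
    refine Finset.sum_congr rfl fun n _ => ?_
    unfold pc; split_ifs <;> simp
  rw [hsum]
  set S := ∑ p ∈ (Finset.range (N+1)).filter Nat.Prime, (1 / (p : ℝ)) * Real.log p with hS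
  have hfac := log_factorial_eq N
  have hf0 : (0 : ℝ) < N.factorial := by exact_mod_cast N.factorial_pos
  have hup : Real.log (N.factorial : ℝ) ≤ N * Real.log N := by
    rw [← Real.log_pow]
    exact Real.log_le_log hf0 (by exact_mod_cast N.factorial_le_pow)
  have hlow : N * Real.log N - N ≤ Real.log (N.factorial : ℝ) := by
    have h := Real.pow_div_factorial_le_exp N hN0.le N
    have h' := Real.log_le_log (by positivity) h
    rw [Real.log_exp, Real.log_div (by positivity) (by positivity), Real.log_pow] at h'
    linarith
  have hth : ∑ p ∈ (Finset.range (N+1)).filter Nat.Prime, Real.log p ≤ Real.log 4 * N := by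
    have h := Chebyshev.theta_le_log4_mul_x hN0.le
    rw [Chebyshev.theta_eq_sum_Icc, Nat.floor_natCast] at h
    rwa [Nat.range_succ_eq_Icc_zero]
  have h1 : N * S - ∑ p ∈ (Finset.range (N+1)).filter Nat.Prime, Real.log p
      ≤ Real.log (N.factorial : ℝ) := by
    rw [hfac, hS, Finset.mul_sum, ← Finset.sum_sub_distrib]
    refine Finset.sum_le_sum fun p hp => ?_
    have hp := (Finset.mem_filter.1 hp).2
    have hl : 0 ≤ Real.log p := Real.log_natCast_nonneg p
    have := mul_le_mul_of_nonneg_right (vp_lower (N := N) hp) hl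
    linarith
  have h2 : Real.log (N.factorial : ℝ) ≤ N * S + N * K1 := by
    have h3 : ∑ p ∈ (Finset.range (N+1)).filter Nat.Prime,
        (1 : ℝ) / (p * (p - 1)) * Real.log p ≤ K1 := by
      refine (Finset.sum_le_sum fun p hp => log_bound ((Finset.mem_filter.1 hp).2.two_le)).trans ?_
      exact hs.sum_le_tsum _ fun n _ => by positivity
    refine le_trans ?_ (add_le_add_right (mul_le_mul_of_nonneg_left h3 hN0.le) _)
    rw [hfac, hS, Finset.mul_sum, Finset.mul_sum, ← Finset.sum_add_distrib]
    refine Finset.sum_le_sum fun p hp => ?_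
    have hp := (Finset.mem_filter.1 hp).2
    have hl : 0 ≤ Real.log p := Real.log_natCast_nonneg p
    have := mul_le_mul_of_nonneg_right (vp_upper (N := N) hp) hl
    linarith
  rw [abs_le]
  constructor
  · have : N * (Real.log N - 1 - K1) ≤ N * S := by linarith
    have := le_of_mul_le_mul_left this hN0
    linarith
  · have : N * S ≤ N * (Real.log N + Real.log 4) := by linarith
    have := le_of_mul_le_mul_left this hN0
    linarith

noncomputable def pT (N : ℕ) : ℝ := ∑ n ∈ Finset.range (N+1), pc n

lemma log_diff_le {a b : ℝ} (ha : 0 < a) (hb : 0 < b) :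
    Real.log b - Real.log a ≤ (b - a) / a := by
  rw [← Real.log_div hb.ne' ha.ne']
  refine (Real.log_le_sub_one_of_pos (by positivity)).trans (le_of_eq ?_)
  field_simp

lemma le_log_diff {a b : ℝ} (ha : 0 < a) (hb : 0 < b) :
    (b - a) / b ≤ Real.log b - Real.log a := by
  have := log_diff_le hb ha
  have h : (a - b) / b = - ((b - a) / b) := by ring
  linarith

lemma loglog_upper {x : ℝ} (hx : 1 < x) :
    Real.log (Real.log (x + 1)) - Real.log (Real.log x) ≤ 1 / (x * Real.log x) := by
  have h0 : 0 < Real.log x := Real.log_pos hx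
  have h1 : 0 < Real.log (x+1) := Real.log_pos (by linarith)
  refine (log_diff_le h0 h1).trans ?_
  have := log_diff_le (a := x) (b := x + 1) (by linarith) (by linarith)
  rw [add_sub_cancel_left] at this
  rw [← div_div]
  gcongr

lemma loglog_lower {x : ℝ} (hx : 1 < x) :
    1 / ((x + 1) * Real.log (x + 1)) ≤ Real.log (Real.log (x + 1)) - Real.log (Real.log x) := by
  have h0 : 0 < Real.log x := Real.log_pos hx
  have h1 : 0 < Real.log (x+1) := Real.log_pos (by linarith)
  refine le_trans ?_ (le_log_diff h0 h1)
  have := le_log_diff (a := x) (b := x + 1) (by linarith) (by linarith)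
  rw [add_sub_cancel_left] at this
  rw [← div_div]
  gcongr

lemma tendsto_h : Tendsto (fun x : ℝ => 1 / (x * Real.log x)) atTop (nhds 0) := by
  simp_rw [one_div]
  exact tendsto_inv_atTop_zero.comp (tendsto_id.atTop_mul_atTop₀ Real.tendsto_log_atTop)

lemma conv_part1 : ∃ C : ℝ, Tendsto (fun n : ℕ => pT (n+1) -
    ∑ i ∈ Finset.range n, 1 / (((i:ℝ)+2) * Real.log ((i:ℝ)+2))) atTop (nhds C) := by
  obtain ⟨K, hK⟩ := mertens_one
  have key := Antitone.cauchySeq_series_mul_of_tendsto_zero_of_bounded (b := K + 2)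
    (f := fun i : ℕ => 1 / Real.log ((i:ℝ)+2))
    (z := fun i : ℕ => pc (i+2) * Real.log ((i:ℝ)+2) - 1 / ((i:ℝ)+2)) ?_ ?_ ?_
  · obtain ⟨C, hC⟩ := cauchySeq_tendsto_of_complete key
    refine ⟨C, hC.congr fun n => ?_⟩
    have hT : pT (n+1) = ∑ i ∈ Finset.range n, pc (i+2) := by
      unfold pT
      rw [Finset.sum_range_succ', Finset.sum_range_succ']
      have p0 : pc 0 = 0 := by simp [pc]
      have p1 : pc 1 = 0 := by simp [pc, Nat.not_prime_one]
      simp [p0, p1]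
    rw [hT, ← Finset.sum_sub_distrib]
    refine Finset.sum_congr rfl fun i _ => ?_
    have : 0 < Real.log ((i:ℝ)+2) := Real.log_pos (by linarith [(Nat.cast_nonneg i : (0:ℝ) ≤ i)])
    rw [smul_eq_mul]
    field_simp
  · intro i j hij
    have h2 : 0 < Real.log ((i:ℝ)+2) := Real.log_pos (by linarith [(Nat.cast_nonneg i : (0:ℝ) ≤ i)])
    have : (i:ℝ) ≤ j := by exact_mod_cast hij
    dsimp only
    gcongr
  · simp_rw [one_div]
    refine tendsto_inv_atTop_zero.comp (Real.tendsto_log_atTop.comp ?_)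
    exact tendsto_atTop_add_const_right _ _ tendsto_natCast_atTop_atTop
  · intro n
    have h1 := hK (n+1) (by omega)
    have hA : ∑ m ∈ Finset.range (n+1+1), pc m * Real.log m =
        ∑ i ∈ Finset.range n, pc (i+2) * Real.log ((i:ℝ)+2) := by
      rw [Finset.sum_range_succ', Finset.sum_range_succ']
      simp only [pc, Nat.not_prime_zero, zero_add, Nat.not_prime_one, if_false, zero_mul, add_zero]
      refine Finset.sum_congr rfl fun i _ => ?_
      push_cast
      rw [show (i:ℝ) + 1 + 1 = i + 2 by ring]
    have hH : ((harmonic (n+1) : ℚ) : ℝ) = 1 + ∑ i ∈ Finset.range n, 1 / ((i:ℝ)+2) := by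
      rw [harmonic, Finset.sum_range_succ']
      push_cast
      rw [add_comm]
      congr 1
      · simp
      · refine Finset.sum_congr rfl fun i _ => ?_
        rw [one_div, show (i:ℝ) + 1 + 1 = i + 2 by ring]
    have hu := harmonic_le_one_add_log (n+1)
    have hl := log_add_one_le_harmonic (n+1)
    have hl' : Real.log ((n+1 : ℕ) : ℝ) ≤ Real.log (((n+1 : ℕ) : ℝ) + 1) :=
      Real.log_le_log (by positivity) (by linarith)
    rw [hH] at hu hl
    rw [hA] at h1
    rw [Finset.sum_sub_distrib, Real.norm_eq_abs, abs_le]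
    rw [abs_le] at h1
    push_cast at h1 hu hl hl'
    constructor <;> linarith [h1.1, h1.2]

lemma conv_part2 : ∃ C : ℝ, Tendsto (fun n : ℕ =>
    ∑ i ∈ Finset.range n, 1 / (((i:ℝ)+2) * Real.log ((i:ℝ)+2)) - Real.log (Real.log ((n:ℝ)+2)))
    atTop (nhds C) := by
  set h : ℕ → ℝ := fun i => 1 / (((i:ℝ)+2) * Real.log ((i:ℝ)+2)) with hh
  set g : ℕ → ℝ := fun i => Real.log (Real.log ((i:ℝ)+2)) with hg
  have up : ∀ i, g (i+1) - g i ≤ h i := fun i => by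
    have := loglog_upper (x := (i:ℝ)+2) (by linarith [(Nat.cast_nonneg i : (0:ℝ) ≤ i)])
    simp only [hh, hg]; push_cast
    rwa [show (i:ℝ)+1+2 = i+2+1 by ring]
  have lo : ∀ i, h (i+1) ≤ g (i+1) - g i := fun i => by
    have := loglog_lower (x := (i:ℝ)+2) (by linarith [(Nat.cast_nonneg i : (0:ℝ) ≤ i)])
    simp only [hh, hg]; push_cast
    rwa [show (i:ℝ)+1+2 = i+2+1 by ring]
  have hpos : ∀ i, 0 ≤ h i := fun i => by
    have : 0 < Real.log ((i:ℝ)+2) := Real.log_pos (by linarith [(Nat.cast_nonneg i : (0:ℝ) ≤ i)])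
    simp only [hh]; positivity
  set d : ℕ → ℝ := fun n => ∑ i ∈ Finset.range n, h i - g n with hd
  have mono : Monotone d := monotone_nat_of_le_succ fun n => by
    simp only [hd, Finset.sum_range_succ]; linarith [up n]
  have bdd : ∀ n, d n ≤ d 0 + h 0 - h n := fun n => by
    induction n with
    | zero => simp
    | succ n ih =>
      simp only [hd, Finset.sum_range_succ] at ih ⊢
      linarith [lo n]
  refine ⟨_, tendsto_atTop_ciSup mono ⟨d 0 + h 0, ?_⟩⟩
  rintro _ ⟨n, rfl⟩
  linarith [bdd n, hpos n]

lemma mertens_two : ∃ C : ℝ, Tendsto (fun u : ℝ => pT ⌊Real.exp u⌋₊ - Real.log u) atTop (nhds C) := by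
  obtain ⟨C1, h1⟩ := conv_part1
  obtain ⟨C2, h2⟩ := conv_part2
  have h3 := h1.add h2
  have h4 : Tendsto (fun N : ℕ => pT N - Real.log (Real.log ((N:ℝ)+1))) atTop (nhds (C1 + C2)) := by
    rw [← tendsto_add_atTop_iff_nat 1]
    refine h3.congr fun n => ?_
    push_cast
    rw [show (n:ℝ)+1+1 = n+2 by ring]; ring
  have hfl : Tendsto (fun u : ℝ => ⌊Real.exp u⌋₊) atTop atTop :=
    tendsto_nat_floor_atTop.comp Real.tendsto_exp_atTop
  have h5 := h4.comp hfl
  have h6 : Tendsto (fun u : ℝ => Real.log (Real.log ((⌊Real.exp u⌋₊:ℝ)+1)) - Real.log u)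
      atTop (nhds 0) := by
    refine tendsto_of_tendsto_of_tendsto_of_le_of_le' tendsto_const_nhds
      (tendsto_h.comp (tendsto_natCast_atTop_atTop.comp hfl)) ?_ ?_
    · filter_upwards [eventually_gt_atTop 0] with u hu
      rw [sub_nonneg]
      refine Real.log_le_log hu ?_
      rw [Real.le_log_iff_exp_le (by positivity)]
      exact (Nat.lt_floor_add_one _).le
    · filter_upwards [eventually_gt_atTop 0, hfl.eventually_ge_atTop 2] with u hu hN
      have hN' : (2:ℝ) ≤ (⌊Real.exp u⌋₊:ℝ) := by exact_mod_cast hN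
      refine le_trans ?_ (loglog_upper (x := (⌊Real.exp u⌋₊:ℝ)) (by linarith))
      gcongr
      · exact Real.log_pos (by linarith)
      · rw [Real.log_le_iff_le_exp (by linarith)]
        exact Nat.floor_le (Real.exp_pos u).le
  refine ⟨C1 + C2, ?_⟩
  have := h5.add h6
  rw [add_zero] at this
  refine this.congr fun u => ?_
  simp only [Function.comp]; ring

lemma pT_mono : Monotone pT := fun a b hab =>
  Finset.sum_le_sum_of_subset_of_nonneg (Finset.range_mono (by omega)) fun _ _ _ => pc_nonneg _

lemma pT_nonneg (N : ℕ) : 0 ≤ pT N := Finset.sum_nonneg fun _ _ => pc_nonneg _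

lemma integral_log_exp : ∫ v in Set.Ioi (0:ℝ), Real.log v * Real.exp (-v) =
    -Real.eulerMascheroniConstant := by
  have h1 := Complex.hasDerivAt_GammaIntegral (s := 1) (by simp)
  have h2 := Complex.hasDerivAt_Gamma_one
  have h3 : Complex.Gamma =ᶠ[nhds 1] Complex.GammaIntegral := by
    have : {s : ℂ | 0 < s.re} ∈ nhds (1:ℂ) :=
      (isOpen_lt continuous_const Complex.continuous_re).mem_nhds (by simp)
    filter_upwards [this] with s hs
    exact Complex.Gamma_eq_integral hs
  have h4 := (h1.congr_of_eventuallyEq h3).unique h2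
  simp only [sub_self, Complex.cpow_zero, one_mul] at h4
  have h5 : ∫ v in Set.Ioi (0:ℝ), ((Real.log v : ℂ) * (Real.exp (-v) : ℂ)) =
    ((∫ v in Set.Ioi (0:ℝ), Real.log v * Real.exp (-v) : ℝ) : ℂ) := by
    rw [← integral_complex_ofReal]
    congr 1; ext v; push_cast; rfl
  rw [h5] at h4
  exact_mod_cast h4

lemma integrable_log_exp : MeasureTheory.IntegrableOn
    (fun v : ℝ => Real.log v * Real.exp (-v)) (Set.Ioi 0) := by
  apply MeasureTheory.Integrable.of_integral_ne_zero
  rw [integral_log_exp]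
  have := Real.one_half_lt_eulerMascheroniConstant
  intro h; linarith

lemma integrable_exp_neg : MeasureTheory.IntegrableOn
    (fun v : ℝ => Real.exp (-v)) (Set.Ioi 0) := integrableOn_exp_neg_Ioi 0

lemma pT_bound {C : ℝ} (hC : Tendsto (fun u : ℝ => pT ⌊Real.exp u⌋₊ - Real.log u) atTop (nhds C)) :
    ∃ K : ℝ, ∀ s : ℝ, 0 < s → s ≤ 1 → ∀ v : ℝ, 0 < v →
      |pT ⌊Real.exp (v/s)⌋₊ - Real.log (v/s)| ≤ K + |Real.log v| := by
  have h1 : ∀ᶠ u : ℝ in atTop, |pT ⌊Real.exp u⌋₊ - Real.log u| < |C| + 1 :=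
    hC.abs.eventually_lt_const (by linarith)
  obtain ⟨U, hU⟩ := (h1.and (eventually_ge_atTop 1)).exists_forall_of_atTop
  have hU1 : 1 ≤ U := (hU U le_rfl).2
  have hlU := Real.log_nonneg hU1
  have hp := pT_nonneg ⌊Real.exp U⌋₊
  refine ⟨|C| + 1 + pT ⌊Real.exp U⌋₊ + Real.log U, fun s hs hs1 v hv => ?_⟩
  have hu : 0 < v / s := by positivity
  have hdiv : Real.log (v/s) = Real.log v - Real.log s := Real.log_div hv.ne' hs.ne'
  have hls : Real.log s ≤ 0 := Real.log_nonpos hs.le hs1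
  rcases le_total U (v/s) with h | h
  · have := (hU _ h).1
    linarith [abs_nonneg (Real.log v)]
  · have hm : pT ⌊Real.exp (v/s)⌋₊ ≤ pT ⌊Real.exp U⌋₊ :=
      pT_mono (Nat.floor_mono (Real.exp_le_exp.2 h))
    have h0 := pT_nonneg ⌊Real.exp (v/s)⌋₊
    have hlog : |Real.log (v/s)| ≤ Real.log U + |Real.log v| := by
      rcases le_total 1 (v/s) with h' | h'
      · rw [abs_of_nonneg (Real.log_nonneg h')]
        linarith [abs_nonneg (Real.log v), Real.log_le_log hu h]
      · rw [abs_of_nonpos (Real.log_nonpos hu.le h'), hdiv]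
        linarith [neg_abs_le (Real.log v)]
    have := abs_sub (pT ⌊Real.exp (v/s)⌋₊) (Real.log (v/s))
    rw [abs_of_nonneg h0] at this
    linarith [abs_nonneg C]

lemma measurable_pT (s : ℝ) : Measurable fun v : ℝ => pT ⌊Real.exp (v/s)⌋₊ := by
  have h1 : Measurable pT := measurable_from_nat
  exact h1.comp (Nat.measurable_floor.comp (by fun_prop))

lemma pc_summable {s : ℝ} (hs : 0 < s) : Summable fun n : ℕ => pc n * (n:ℝ) ^ (-s) := by
  refine Summable.of_nonneg_of_le (fun n => mul_nonneg (pc_nonneg n) (by positivity)) (fun n => ?_)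
    (Real.summable_nat_rpow.2 (show -(1+s) < -1 by linarith))
  unfold pc
  split_ifs with h
  · have : (0:ℝ) < n := by exact_mod_cast h.pos
    rw [show -(1+s) = -1 + -s by ring, Real.rpow_add this, Real.rpow_neg_one, one_div]
  · rw [zero_mul]; positivity

lemma laplace {s : ℝ} (hs : 0 < s) : ∑' n : ℕ, pc n * (n:ℝ) ^ (-s) =
    ∫ v in Set.Ioi (0:ℝ), pT ⌊Real.exp (v/s)⌋₊ * Real.exp (-v) := by
  set F : ℕ → ℝ → ℝ := fun n v => pc n * (Set.Ici (s * Real.log n)).indicator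
    (fun v => Real.exp (-v)) v with hF
  have hint : ∀ n, MeasureTheory.Integrable (F n) (MeasureTheory.volume.restrict (Set.Ioi (0:ℝ))) :=
    fun n => (MeasureTheory.Integrable.indicator integrable_exp_neg measurableSet_Ici).const_mul _
  have hval : ∀ n, ∫ v in Set.Ioi (0:ℝ), F n v = pc n * (n:ℝ) ^ (-s) := by
    intro n
    simp only [hF]
    rw [MeasureTheory.integral_const_mul]
    by_cases hn : n.Prime
    · congr 1
      have hn1 : (1:ℝ) < n := by exact_mod_cast hn.one_lt
      have hpos : 0 < s * Real.log n := mul_pos hs (Real.log_pos hn1)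
      rw [MeasureTheory.setIntegral_indicator measurableSet_Ici,
        Set.inter_eq_right.2 (Set.Ici_subset_Ioi.2 hpos),
        MeasureTheory.integral_Ici_eq_integral_Ioi, integral_exp_neg_Ioi,
        Real.rpow_def_of_pos (by linarith)]
      congr 1; ring
    · simp [pc, hn]
  have hnn : ∀ n v, 0 ≤ F n v := fun n v =>
    mul_nonneg (pc_nonneg n) (Set.indicator_nonneg (fun _ _ => (Real.exp_pos _).le) _)
  have hsum : Summable fun n => ∫ v in Set.Ioi (0:ℝ), ‖F n v‖ := by
    refine (pc_summable hs).congr fun n => ?_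
    rw [← hval n]
    congr 1; ext v
    rw [Real.norm_of_nonneg (hnn n v)]
  have key := MeasureTheory.hasSum_integral_of_summable_integral_norm hint hsum
  simp_rw [hval] at key
  rw [key.tsum_eq]
  refine MeasureTheory.setIntegral_congr_fun measurableSet_Ioi fun v hv => ?_
  have hv : 0 < v := hv
  rw [tsum_eq_sum (s := Finset.range (⌊Real.exp (v/s)⌋₊ + 1)), pT, Finset.sum_mul]
  · refine Finset.sum_congr rfl fun n hn => ?_
    by_cases hp : n.Prime
    · have h1 : (n:ℝ) ≤ Real.exp (v/s) :=
        (Nat.le_floor_iff (Real.exp_pos _).le).1 (by simpa [Nat.lt_succ_iff] using hn)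
      have hn0 : (0:ℝ) < n := by exact_mod_cast hp.pos
      have h2 : Real.log n ≤ v / s := (Real.log_le_iff_le_exp hn0).2 h1
      have h3 : v ∈ Set.Ici (s * Real.log n) := by
        rw [le_div_iff₀ hs] at h2
        simp only [Set.mem_Ici]; linarith
      simp only [hF, Set.indicator_of_mem h3]
    · simp [hF, pc, hp]
  · intro n hn
    have h1 : Real.exp (v/s) < n := by
      rw [← Nat.floor_lt (Real.exp_pos _).le]
      simpa using hn
    have hn0 : (0:ℝ) < n := (Real.exp_pos _).trans h1
    have h2 : v / s < Real.log n := (Real.lt_log_iff_exp_lt hn0).2 h1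
    have h3 : v ∉ Set.Ici (s * Real.log n) := by
      rw [div_lt_iff₀ hs] at h2
      simp only [Set.mem_Ici, not_le]; linarith
    simp only [hF, Set.indicator_of_notMem h3, mul_zero]

lemma laplace_tendsto {C : ℝ}
    (hC : Tendsto (fun u : ℝ => pT ⌊Real.exp u⌋₊ - Real.log u) atTop (nhds C)) :
    Tendsto (fun s : ℝ => ∑' n : ℕ, pc n * (n:ℝ) ^ (-s) + Real.log s) (nhdsWithin 0 (Set.Ioi 0))
      (nhds (C - Real.eulerMascheroniConstant)) := by
  obtain ⟨K, hK⟩ := pT_bound hC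
  set G : ℝ → ℝ → ℝ := fun s v => (pT ⌊Real.exp (v/s)⌋₊ - Real.log (v/s)) * Real.exp (-v) with hG
  have hmeas : ∀ s, MeasureTheory.AEStronglyMeasurable (G s)
      (MeasureTheory.volume.restrict (Set.Ioi (0:ℝ))) := fun s => by
    apply Measurable.aestronglyMeasurable
    have := measurable_pT s
    have h2 : Measurable fun v : ℝ => Real.log (v/s) := by fun_prop
    exact (this.sub h2).mul (by fun_prop)
  have hbint : MeasureTheory.IntegrableOn (fun v : ℝ => K * Real.exp (-v) +
      |Real.log v * Real.exp (-v)|) (Set.Ioi 0) :=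
    (integrable_exp_neg.const_mul K).add integrable_log_exp.abs
  have hb : ∀ s : ℝ, 0 < s → s ≤ 1 → ∀ v ∈ Set.Ioi (0:ℝ), ‖G s v‖ ≤ K * Real.exp (-v) +
      |Real.log v * Real.exp (-v)| := fun s hs hs1 v hv => by
    rw [hG, Real.norm_eq_abs, abs_mul, abs_mul, abs_of_pos (Real.exp_pos _), ← add_mul]
    exact mul_le_mul_of_nonneg_right (hK s hs hs1 v hv) (Real.exp_pos _).le
  have hev : ∀ᶠ s : ℝ in nhdsWithin 0 (Set.Ioi 0), 0 < s ∧ s ≤ 1 := by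
    filter_upwards [Ioc_mem_nhdsGT (show (0:ℝ) < 1 by norm_num)] with s hs using hs
  have lim : Tendsto (fun s => ∫ v in Set.Ioi (0:ℝ), G s v) (nhdsWithin 0 (Set.Ioi 0))
      (nhds (∫ v in Set.Ioi (0:ℝ), C * Real.exp (-v))) := by
    refine MeasureTheory.tendsto_integral_filter_of_dominated_convergence _
      (Eventually.of_forall hmeas) ?_ hbint ?_
    · filter_upwards [hev] with s hs
      filter_upwards [MeasureTheory.ae_restrict_mem measurableSet_Ioi] with v hv
      exact hb s hs.1 hs.2 v hv
    · filter_upwards [MeasureTheory.ae_restrict_mem measurableSet_Ioi] with v hv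
      refine Tendsto.mul_const _ (hC.comp ?_)
      exact Tendsto.const_mul_atTop (show 0 < v from hv) tendsto_inv_nhdsGT_zero
  rw [MeasureTheory.integral_const_mul, integral_exp_neg_Ioi] at lim
  simp only [neg_zero, Real.exp_zero, mul_one] at lim
  refine (lim.sub_const Real.eulerMascheroniConstant).congr' ?_
  filter_upwards [hev] with s hs
  have hGi : MeasureTheory.IntegrableOn (G s) (Set.Ioi 0) := by
    refine MeasureTheory.Integrable.mono' hbint (hmeas s) ?_
    filter_upwards [MeasureTheory.ae_restrict_mem measurableSet_Ioi] with v hv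
    exact hb s hs.1 hs.2 v hv
  rw [laplace hs.1]
  have e : ∫ v in Set.Ioi (0:ℝ), pT ⌊Real.exp (v/s)⌋₊ * Real.exp (-v) =
      ∫ v in Set.Ioi (0:ℝ), (G s v + (Real.log v * Real.exp (-v) - Real.log s * Real.exp (-v))) := by
    refine MeasureTheory.setIntegral_congr_fun measurableSet_Ioi fun v hv => ?_
    have hv : 0 < v := hv
    simp only [hG]
    rw [Real.log_div hv.ne' hs.1.ne']; ring
  have hi2 : MeasureTheory.Integrable (fun v : ℝ => Real.log v * Real.exp (-v) -
      Real.log s * Real.exp (-v)) (MeasureTheory.volume.restrict (Set.Ioi (0:ℝ))) :=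
    integrable_log_exp.sub (integrable_exp_neg.const_mul _)
  rw [e, MeasureTheory.integral_add hGi hi2,
    MeasureTheory.integral_sub integrable_log_exp (integrable_exp_neg.const_mul _),
    integral_log_exp, MeasureTheory.integral_const_mul, integral_exp_neg_Ioi]
  simp only [neg_zero, Real.exp_zero]
  ring

noncomputable def lg (t : ℝ) (n : ℕ) : ℝ := if n.Prime then -Real.log (1 - (n:ℝ) ^ (-t)) else 0

lemma neglog_bounds {x : ℝ} (h0 : 0 ≤ x) (h1 : x ≤ 1/2) :
    x ≤ -Real.log (1 - x) ∧ -Real.log (1 - x) ≤ x + 2 * x ^ 2 := by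
  have h := Real.log_le_sub_one_of_pos (show 0 < 1 - x by linarith)
  have h' := Real.one_sub_inv_le_log_of_pos (show 0 < 1 - x by linarith)
  refine ⟨by linarith, ?_⟩
  have : (1 - x)⁻¹ ≤ 1 + x + 2 * x^2 := by
    rw [inv_le_iff_one_le_mul₀ (by linarith)]
    nlinarith [mul_nonneg (mul_nonneg h0 h0) (show 0 ≤ 1 - 2 * x by linarith)]
  linarith

lemma rpow_le_inv {n : ℕ} (hn : n.Prime) {t : ℝ} (ht : 1 ≤ t) : (n:ℝ) ^ (-t) ≤ (n:ℝ)⁻¹ := by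
  rw [← Real.rpow_neg_one]
  exact Real.rpow_le_rpow_of_exponent_le (by exact_mod_cast hn.one_le) (by linarith)

lemma rpow_le_half {n : ℕ} (hn : n.Prime) {t : ℝ} (ht : 1 ≤ t) : (n:ℝ) ^ (-t) ≤ 1/2 := by
  refine (rpow_le_inv hn ht).trans ?_
  rw [one_div]
  exact inv_anti₀ (by norm_num) (by exact_mod_cast hn.two_le)

lemma lg_summable {t : ℝ} (ht : 1 < t) : Summable (lg t) := by
  refine Summable.of_nonneg_of_le (fun n => ?_) (fun n => ?_)
    ((Real.summable_nat_rpow.2 (show -t < -1 by linarith)).mul_left 2)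
  · unfold lg
    split_ifs with h
    · exact le_trans (by positivity) (neglog_bounds (by positivity) (rpow_le_half h ht.le)).1
    · exact le_rfl
  · unfold lg
    split_ifs with h
    · have h2 := rpow_le_half h ht.le
      have h0 : 0 ≤ (n:ℝ) ^ (-t) := by positivity
      have := (neglog_bounds h0 h2).2
      nlinarith
    · positivity

noncomputable def rpowHom (t : ℝ) (ht : 1 < t) : ℕ →*₀ ℝ where
  toFun n := (n:ℝ) ^ (-t)
  map_zero' := by
    rw [Nat.cast_zero, Real.zero_rpow (by linarith)]
  map_one' := by simp
  map_mul' m n := by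
    push_cast
    rw [Real.mul_rpow (by positivity) (by positivity)]

lemma lg_tsum {t : ℝ} (ht : 1 < t) : ∑' n, lg t n = Real.log (∑' n : ℕ, 1 / (n:ℝ) ^ t) := by
  have h1 := EulerProduct.eulerProduct_completely_multiplicative_hasProd (f := rpowHom t ht) (by
    refine (Real.summable_nat_rpow.2 (show -t < -1 by linarith)).congr fun n => ?_
    exact (Real.norm_of_nonneg (show 0 ≤ (n:ℝ) ^ (-t) by positivity)).symm)
  have hind : lg t = Set.indicator {p | Nat.Prime p} (fun n => -Real.log (1 - (n:ℝ) ^ (-t))) := by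
    ext n; simp [lg, Set.indicator]
  have h2 : HasSum (fun p : Nat.Primes => Real.log ((1 - rpowHom t ht p)⁻¹)) (∑' n, lg t n) := by
    have := (lg_summable ht).hasSum
    rw [hind] at this ⊢
    rw [← hasSum_subtype_iff_indicator] at this
    refine this.congr_fun ?_
    intro p
    simp [rpowHom, Real.log_inv]
  have h3 := Real.hasProd_of_hasSum_log (fun p : Nat.Primes => by
    have := rpow_le_half p.2 ht.le
    have h' : rpowHom t ht p = ((p:ℕ):ℝ) ^ (-t) := rfl
    rw [h']
    have : 0 < 1 - ((p:ℕ):ℝ) ^ (-t) := by linarith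
    positivity) h2
  have h4 := h3.unique h1
  have h5 : ∑' n : ℕ, 1 / (n:ℝ) ^ t = ∑' n, rpowHom t ht n := by
    refine tsum_congr fun n => ?_
    change _ = (n:ℝ) ^ (-t)
    rw [Real.rpow_neg (by positivity), one_div]
  rw [h5, ← h4, Real.log_exp]

lemma H_tendsto : Tendsto (fun s : ℝ => ∑' n : ℕ, (lg (1+s) n - pc n * (n:ℝ) ^ (-s)))
    (nhdsWithin 0 (Set.Ioi 0)) (nhds (∑' n : ℕ, (lg 1 n - pc n))) ∧
    Summable (fun n : ℕ => lg 1 n - pc n) := by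
  have hb : ∀ s : ℝ, 0 ≤ s → ∀ n : ℕ, ‖lg (1+s) n - pc n * (n:ℝ) ^ (-s)‖ ≤
      2 * (1 / (n:ℝ) ^ 2) := by
    intro s hs n
    unfold lg pc
    split_ifs with h
    · have hn : (0:ℝ) < n := by exact_mod_cast h.pos
      have e : 1 / (n:ℝ) * (n:ℝ) ^ (-s) = (n:ℝ) ^ (-(1+s)) := by
        rw [show -(1+s) = -1 + -s by ring, Real.rpow_add hn, Real.rpow_neg_one, one_div]
      rw [e]
      have h0 : 0 ≤ (n:ℝ) ^ (-(1+s)) := by positivity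
      have h1 := rpow_le_half h (show 1 ≤ 1 + s by linarith)
      have h2 := rpow_le_inv h (show 1 ≤ 1 + s by linarith)
      obtain ⟨h3, h4⟩ := neglog_bounds h0 h1
      rw [Real.norm_of_nonneg (by linarith)]
      have h5 : ((n:ℝ) ^ (-(1+s))) ^ 2 ≤ ((n:ℝ)⁻¹) ^ 2 := by gcongr
      rw [inv_pow, ← one_div] at h5
      linarith
    · simp
  have hsb : Summable fun n : ℕ => 2 * (1 / (n:ℝ) ^ 2) :=
    (Real.summable_one_div_nat_pow.2 (by norm_num)).mul_left 2
  constructor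
  · refine tendsto_tsum_of_dominated_convergence hsb (fun n => ?_) ?_
    · refine Tendsto.mono_left ?_ nhdsWithin_le_nhds
      by_cases h : n.Prime
      · have hn : (0:ℝ) < n := by exact_mod_cast h.pos
        have hne : 1 - (n:ℝ) ^ (-(1+(0:ℝ))) ≠ 0 := by
          have := rpow_le_half h (t := 1 + 0) (by norm_num)
          exact (sub_pos.2 (lt_of_le_of_lt this (by norm_num))).ne'
        have hc1 : ContinuousAt (fun s : ℝ => (n:ℝ) ^ (-(1+s))) 0 :=
          ContinuousAt.rpow continuousAt_const (by fun_prop) (Or.inl hn.ne')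
        have hc2 : ContinuousAt (fun s : ℝ => (n:ℝ) ^ (-s)) 0 :=
          ContinuousAt.rpow continuousAt_const (by fun_prop) (Or.inl hn.ne')
        have hc : ContinuousAt (fun s : ℝ => -Real.log (1 - (n:ℝ) ^ (-(1+s))) -
            1 / (n:ℝ) * (n:ℝ) ^ (-s)) 0 :=
          ((continuousAt_const.sub hc1).log hne).neg.sub (continuousAt_const.mul hc2)
        have := hc.tendsto
        simpa [lg, pc, h] using this
      · simp [lg, pc, h]
    · filter_upwards [self_mem_nhdsWithin] with s hs n
      exact hb s (le_of_lt hs) n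
  · refine Summable.of_norm_bounded hsb fun n => ?_
    simpa using hb 0 le_rfl n

lemma mertens_three : Tendsto (fun u : ℝ => ∑ n ∈ Finset.range (⌊Real.exp u⌋₊ + 1), lg 1 n -
    Real.log u) atTop (nhds Real.eulerMascheroniConstant) := by
  obtain ⟨C, hC⟩ := mertens_two
  have h1 := laplace_tendsto hC
  obtain ⟨h2, h3⟩ := H_tendsto
  have hz : Tendsto (fun s : ℝ => ∑' n, lg (1+s) n + Real.log s) (nhdsWithin 0 (Set.Ioi 0))
      (nhds 0) := by
    have ha : Tendsto (fun s : ℝ => 1 + s) (nhdsWithin 0 (Set.Ioi 0)) (nhdsWithin 1 (Set.Ioi 1)) := by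
      refine tendsto_nhdsWithin_of_tendsto_nhds_of_eventually_within _ ?_ ?_
      · refine Tendsto.mono_left ?_ nhdsWithin_le_nhds
        have : ContinuousAt (fun s : ℝ => 1 + s) 0 := by fun_prop
        simpa using this.tendsto
      · filter_upwards [self_mem_nhdsWithin] with s hs
        have : 0 < s := hs
        simp only [Set.mem_Ioi]; linarith
    have hb := (tendsto_sub_mul_tsum_nat_rpow.comp ha).log one_ne_zero
    rw [Real.log_one] at hb
    refine hb.congr' ?_
    filter_upwards [self_mem_nhdsWithin] with s hs
    have hs : 0 < s := hs
    simp only [Function.comp, add_sub_cancel_left]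
    rw [lg_tsum (by linarith), Real.log_mul hs.ne', add_comm]
    have hsm : Summable fun n : ℕ => 1 / (n:ℝ) ^ (1+s) :=
      Real.summable_one_div_nat_rpow.2 (by linarith)
    refine (lt_of_lt_of_le ?_ (hsm.le_tsum 1 fun n _ => by positivity)).ne'
    simp
  have h4 : C - Real.eulerMascheroniConstant + ∑' n : ℕ, (lg 1 n - pc n) = 0 := by
    refine tendsto_nhds_unique (h1.add h2) (hz.congr' ?_)
    filter_upwards [self_mem_nhdsWithin] with s hs
    have hs : 0 < s := hs
    rw [(lg_summable (by linarith)).tsum_sub (pc_summable hs)]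
    ring
  have hfl : Tendsto (fun u : ℝ => ⌊Real.exp u⌋₊ + 1) atTop atTop :=
    (tendsto_add_atTop_nat 1).comp (tendsto_nat_floor_atTop.comp Real.tendsto_exp_atTop)
  have h5 := hC.add (h3.hasSum.tendsto_sum_nat.comp hfl)
  rw [show C + ∑' n : ℕ, (lg 1 n - pc n) = Real.eulerMascheroniConstant by linarith] at h5
  refine h5.congr fun u => ?_
  simp only [Function.comp, pT, Finset.sum_sub_distrib]
  ring

noncomputable def gf (X : ℝ) (n : ℕ) : ℝ :=
  if (n:ℝ) ≤ Real.sqrt X then (n:ℝ) / (n + 1) else (2 * (n:ℝ)^2 - n + 1) / (2 * (n:ℝ)^2 + n)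

lemma gf_pos {X : ℝ} {n : ℕ} (hn : n.Prime) : 0 < gf X n := by
  have h : (2:ℝ) ≤ n := by exact_mod_cast hn.two_le
  unfold gf
  split_ifs
  · positivity
  · have : 0 < 2 * (n:ℝ)^2 - n + 1 := by nlinarith
    positivity

noncomputable def qf (X : ℝ) (n : ℕ) : ℝ :=
  if n.Prime ∧ n ≤ ⌊X⌋₊ then Real.log (gf X n) + lg 1 n else 0

lemma qf_small {X : ℝ} {n : ℕ} (hn : n.Prime) (h : (n:ℝ) ≤ Real.sqrt X) :
    Real.log (gf X n) + lg 1 n = lg 2 n := by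
  have h2 : (2:ℝ) ≤ n := by exact_mod_cast hn.two_le
  have e2 : (n:ℝ) ^ (-(2:ℝ)) = ((n:ℝ)^2)⁻¹ := by
    rw [Real.rpow_neg (by positivity)]; norm_num
  have hb : 0 < 1 - (n:ℝ)⁻¹ := by
    have : (n:ℝ)⁻¹ < 1 := inv_lt_one_of_one_lt₀ (by linarith)
    linarith
  have hc : 0 < 1 + (n:ℝ)⁻¹ := by positivity
  simp only [gf, lg, h, hn, if_true, e2, Real.rpow_neg_one]
  have e1 : (n:ℝ) / (n+1) = (1 + (n:ℝ)⁻¹)⁻¹ := by field_simp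
  have e3 : 1 - ((n:ℝ)^2)⁻¹ = (1 + (n:ℝ)⁻¹) * (1 - (n:ℝ)⁻¹) := by field_simp; ring
  rw [e1, e3, Real.log_inv, Real.log_mul hc.ne' hb.ne']
  ring

lemma qf_bound (X : ℝ) (n : ℕ) : ‖qf X n‖ ≤ 2 * (1 / (n:ℝ)^2) := by
  unfold qf
  split_ifs with hn
  · have hn := hn.1
    have h2 : (2:ℝ) ≤ n := by exact_mod_cast hn.two_le
    by_cases h : (n:ℝ) ≤ Real.sqrt X
    · rw [qf_small hn h]
      have e2 : (n:ℝ) ^ (-(2:ℝ)) = 1 / (n:ℝ)^2 := by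
        rw [Real.rpow_neg (by positivity), one_div]; norm_num
      have h0 : 0 ≤ (n:ℝ) ^ (-(2:ℝ)) := by positivity
      have h1 := rpow_le_half hn (t := 2) (by norm_num)
      obtain ⟨h3, h4⟩ := neglog_bounds h0 h1
      simp only [lg, hn, if_true]
      rw [Real.norm_of_nonneg (by linarith), ← e2]
      nlinarith
    · have hb : 0 < 1 - (n:ℝ)⁻¹ := by
        have : (n:ℝ)⁻¹ < 1 := inv_lt_one_of_one_lt₀ (by linarith)
        linarith
      have hg := gf_pos (X := X) hn
      have hd : 0 < (2 * (n:ℝ) + 1) * (n - 1) := by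
        have : 0 < (n:ℝ) - 1 := by linarith
        positivity
      have e : gf X n / (1 - (n:ℝ)⁻¹) = 1 + 2 / ((2 * (n:ℝ) + 1) * (n - 1)) := by
        have : (n:ℝ) - 1 ≠ 0 := by linarith
        simp only [gf, h, if_false]
        field_simp
        ring
      have e' : Real.log (gf X n) + lg 1 n = Real.log (1 + 2 / ((2 * (n:ℝ) + 1) * (n - 1))) := by
        rw [← e, Real.log_div hg.ne' hb.ne']
        simp only [lg, hn, if_true, Real.rpow_neg_one]
        ring
      have hx : 0 < 2 / ((2 * (n:ℝ) + 1) * (n - 1)) := by positivity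
      rw [e', Real.norm_of_nonneg (Real.log_nonneg (by linarith))]
      have := Real.log_le_sub_one_of_pos (show 0 < 1 + 2 / ((2 * (n:ℝ) + 1) * (n - 1)) by linarith)
      have h3 : 2 / ((2 * (n:ℝ) + 1) * (n - 1)) ≤ 2 / (n:ℝ)^2 := by
        gcongr
        nlinarith
      rw [mul_one_div]
      linarith
  · rw [norm_zero]; positivity

lemma qf_tendsto : Tendsto (fun X : ℝ => ∑ n ∈ (Finset.range (⌊X⌋₊ + 1)).filter Nat.Prime,
    Real.log (gf X n) + ∑ n ∈ Finset.range (⌊X⌋₊ + 1), lg 1 n) atTop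
    (nhds (Real.log (π^2/6))) := by
  have hsb : Summable fun n : ℕ => 2 * (1 / (n:ℝ) ^ 2) :=
    (Real.summable_one_div_nat_pow.2 (by norm_num)).mul_left 2
  have h1 : Tendsto (fun X => ∑' n, qf X n) atTop (nhds (∑' n, lg 2 n)) := by
    refine tendsto_tsum_of_dominated_convergence hsb (fun n => ?_)
      (Eventually.of_forall fun X n => qf_bound X n)
    refine tendsto_const_nhds.congr' ?_
    filter_upwards [Real.tendsto_sqrt_atTop.eventually_ge_atTop (n:ℝ),
      tendsto_nat_floor_atTop.eventually_ge_atTop n] with X hX hX2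
    by_cases hn : n.Prime
    · simp only [qf, hn, hX2, and_self, if_true]
      rw [qf_small hn hX]
    · simp [qf, hn, lg]
  rw [lg_tsum (by norm_num)] at h1
  have e : ∑' n : ℕ, 1 / (n:ℝ) ^ (2:ℝ) = π^2/6 := by
    rw [← hasSum_zeta_two.tsum_eq]
    refine tsum_congr fun n => ?_
    norm_num
  rw [e] at h1
  refine h1.congr fun X => ?_
  rw [tsum_eq_sum (s := Finset.range (⌊X⌋₊ + 1)), Finset.sum_filter, ← Finset.sum_add_distrib]
  · refine Finset.sum_congr rfl fun n hn => ?_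
    have hn : n ≤ ⌊X⌋₊ := by simpa [Nat.lt_succ_iff] using hn
    by_cases hp : n.Prime
    · simp [qf, hp, hn]
    · simp [qf, hp, lg]
  · intro n hn
    have hn : ¬ n ≤ ⌊X⌋₊ := by simpa [Nat.lt_succ_iff] using hn
    simp [qf, hn]

lemma euler_finite {X : ℝ} (hX : 2 ≤ X) (b : ℕ → ℝ)
    (h1 : b 1 = 1)
    (hmul : ∀ m n : ℕ, Nat.Coprime m n → b (m * n) = b m * b n)
    (hsmall : ∀ p : ℕ, p.Prime → (p : ℝ) ≤ Real.sqrt X →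
      b p = -(1 + 1 / (p : ℝ))⁻¹ ∧ ∀ j : ℕ, 2 ≤ j → b (p ^ j) = 0)
    (hlarge : ∀ p : ℕ, p.Prime →
      Real.sqrt X < (p : ℝ) → (p : ℝ) ≤ X →
      b p = -(1 + 1 / (2 * (p : ℝ)))⁻¹ ∧
        b (p ^ 2) = (2 * (1 + 1 / (2 * (p : ℝ))))⁻¹ ∧
        ∀ j : ℕ, 3 ≤ j → b (p ^ j) = 0)
    (hrough : ∀ p : ℕ, p.Prime → X < (p : ℝ) → ∀ j : ℕ, 1 ≤ j → b (p ^ j) = 0) :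
    ∑' n : ℕ, b (n + 1) / (n + 1 : ℝ) =
      ∏ p ∈ (Finset.range (⌊X⌋₊ + 1)).filter Nat.Prime, gf X p := by
  set f : ℕ → ℝ := fun n => b n / (n:ℝ) with hf
  have f1 : f 1 = 1 := by simp [hf, h1]
  have fmul : ∀ {m n : ℕ}, m.Coprime n → f (m * n) = f m * f n := by
    intro m n hmn
    simp only [hf, hmul m n hmn]; push_cast
    rw [mul_div_mul_comm]
  have fz : ∀ p : ℕ, p.Prime → ∀ j, 3 ≤ j → f (p ^ j) = 0 := by
    intro p hp j hj
    have : b (p ^ j) = 0 := by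
      rcases le_or_gt (p:ℝ) (Real.sqrt X) with h | h
      · exact (hsmall p hp h).2 j (by omega)
      · rcases le_or_gt (p:ℝ) X with h' | h'
        · exact (hlarge p hp h h').2.2 j hj
        · exact hrough p hp h' j (by omega)
    simp [hf, this]
  have fsum : ∀ {p : ℕ}, p.Prime → Summable fun n => ‖f (p ^ n)‖ := by
    intro p hp
    refine summable_of_ne_finset_zero (s := Finset.range 3) fun j hj => ?_
    rw [fz p hp j (by simpa using hj), norm_zero]
  have key := (EulerProduct.summable_and_hasSum_factoredNumbers_prod_filter_prime_tsum f1 fmul fsum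
    (Finset.range (⌊X⌋₊ + 1))).2
  have hsupp : Function.support f ⊆ Nat.factoredNumbers (Finset.range (⌊X⌋₊ + 1)) := by
    intro n hn
    rw [Function.mem_support] at hn
    have hn0 : n ≠ 0 := by rintro rfl; simp [hf] at hn
    rw [Nat.mem_factoredNumbers']
    intro p hp hpn
    by_contra hcon
    apply hn
    have hpX : X < p := by
      rw [← Nat.floor_lt (by linarith)]
      simpa using hcon
    obtain ⟨k, m, hm, hkm⟩ := Nat.exists_eq_pow_mul_and_not_dvd hn0 p hp.ne_one
    have hk : 1 ≤ k := by
      rcases Nat.eq_zero_or_pos k with rfl | h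
      · simp at hkm; rw [hkm] at hpn; exact absurd hpn hm
      · exact h
    have : b n = 0 := by
      rw [hkm, hmul _ _ (Nat.Coprime.pow_left _ ((Nat.Prime.coprime_iff_not_dvd hp).2 hm)),
        hrough p hp hpX k hk, zero_mul]
    simp [hf, this]
  have key2 : HasSum f (∏ p ∈ (Finset.range (⌊X⌋₊ + 1)).filter Nat.Prime, ∑' e, f (p ^ e)) :=
    (hasSum_subtype_iff_of_support_subset hsupp).1 key
  have key3 := key2.tsum_eq
  rw [key2.summable.tsum_eq_zero_add] at key3
  have f0 : f 0 = 0 := by simp [hf]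
  rw [f0, zero_add] at key3
  have e : ∑' n : ℕ, b (n + 1) / (n + 1 : ℝ) = ∑' n : ℕ, f (n + 1) := by
    refine tsum_congr fun n => ?_
    simp [hf]
  rw [e, key3]
  refine Finset.prod_congr rfl fun p hp => ?_
  rw [Finset.mem_filter, Finset.mem_range, Nat.lt_succ_iff] at hp
  obtain ⟨hpX, hp⟩ := hp
  have hpX : (p:ℝ) ≤ X := (Nat.le_floor_iff (by linarith)).1 hpX
  have hp0 : (0:ℝ) < p := by exact_mod_cast hp.pos
  rw [tsum_eq_sum (s := Finset.range 3) (fun j hj => fz p hp j (by simpa using hj))]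
  simp only [Finset.sum_range_succ, Finset.sum_range_zero, pow_zero, pow_one, f1, zero_add]
  rcases le_or_gt (p:ℝ) (Real.sqrt X) with h | h
  · obtain ⟨ha, hb⟩ := hsmall p hp h
    simp only [hf, ha, hb 2 le_rfl, gf, h, if_true]
    field_simp
    ring
  · obtain ⟨ha, hb, -⟩ := hlarge p hp h hpX
    simp only [hf, ha, hb, gf, not_le.2 h, if_false]
    push_cast
    field_simp
    ring


/-- As `X → ∞`, `∑_{n X-smooth} β₁(n)/n ~ ζ(2)/(e^γ log X)`,
where for each `X` the function `β₁ = β X` is multiplicative, supported on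
`X`-smooth integers, with `β₁(p) = -(1+1/p)⁻¹`, `β₁(p^j) = 0` (`j ≥ 2`) for
`p ≤ √X`, and `β₁(p) = -(1+1/(2p))⁻¹`, `β₁(p²) = (2(1+1/(2p)))⁻¹`,
`β₁(p^j) = 0` (`j ≥ 3`) for `√X < p ≤ X`.  Here `ζ(2) = π²/6` and `γ` is
Euler's constant. -/
theorem sum_beta_one_asymptotic (β : ℝ → ℕ → ℝ)
    (h1 : ∀ X : ℝ, 2 ≤ X → β X 1 = 1)
    (hmul : ∀ X : ℝ, 2 ≤ X → ∀ m n : ℕ, Nat.Coprime m n →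
      β X (m * n) = β X m * β X n)
    (hsmall : ∀ X : ℝ, 2 ≤ X → ∀ p : ℕ, p.Prime → (p : ℝ) ≤ Real.sqrt X →
      β X p = -(1 + 1 / (p : ℝ))⁻¹ ∧ ∀ j : ℕ, 2 ≤ j → β X (p ^ j) = 0)
    (hlarge : ∀ X : ℝ, 2 ≤ X → ∀ p : ℕ, p.Prime →
      Real.sqrt X < (p : ℝ) → (p : ℝ) ≤ X →
      β X p = -(1 + 1 / (2 * (p : ℝ)))⁻¹ ∧
        β X (p ^ 2) = (2 * (1 + 1 / (2 * (p : ℝ))))⁻¹ ∧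
        ∀ j : ℕ, 3 ≤ j → β X (p ^ j) = 0)
    (hrough : ∀ X : ℝ, 2 ≤ X → ∀ p : ℕ, p.Prime → X < (p : ℝ) →
      ∀ j : ℕ, 1 ≤ j → β X (p ^ j) = 0) :
    Tendsto (fun X : ℝ =>
        (∑' n : ℕ, β X (n + 1) / (n + 1 : ℝ))
          / ((π ^ 2 / 6) / (Real.exp Real.eulerMascheroniConstant * Real.log X)))
      atTop (nhds 1) := by

  have hm := mertens_three.comp Real.tendsto_log_atTop
  have h := (qf_tendsto.sub hm).sub_const (Real.log (π^2/6) - Real.eulerMascheroniConstant)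
  rw [sub_self] at h
  have h' := (Real.continuous_exp.tendsto 0).comp h
  rw [Real.exp_zero] at h'
  refine h'.congr' ?_
  filter_upwards [eventually_ge_atTop 2] with X hX
  rw [euler_finite hX (β X) (h1 X hX) (hmul X hX) (hsmall X hX) (hlarge X hX) (hrough X hX)]
  have hlX : 0 < Real.log X := Real.log_pos (by linarith)
  have hpi : 0 < π^2/6 := by positivity
  have hP : 0 < ∏ p ∈ (Finset.range (⌊X⌋₊ + 1)).filter Nat.Prime, gf X p :=
    Finset.prod_pos fun p hp => gf_pos (Finset.mem_filter.1 hp).2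
  have hlog : ∑ n ∈ (Finset.range (⌊X⌋₊ + 1)).filter Nat.Prime, Real.log (gf X n) =
      Real.log (∏ p ∈ (Finset.range (⌊X⌋₊ + 1)).filter Nat.Prime, gf X p) :=
    (Real.log_prod fun p hp => (gf_pos (Finset.mem_filter.1 hp).2).ne').symm
  simp only [Function.comp, Real.exp_log (show 0 < X by linarith)]
  rw [hlog]
  set P := ∏ p ∈ (Finset.range (⌊X⌋₊ + 1)).filter Nat.Prime, gf X p
  set V := ∑ n ∈ Finset.range (⌊X⌋₊ + 1), lg 1 n
  rw [show Real.log P + V - (V - Real.log (Real.log X)) -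
    (Real.log (π^2/6) - Real.eulerMascheroniConstant) =
    Real.log P + Real.log (Real.log X) + Real.eulerMascheroniConstant - Real.log (π^2/6) by ring,
    Real.exp_sub, Real.exp_add, Real.exp_add, Real.exp_log hP, Real.exp_log hlX, Real.exp_log hpi]
  field_simp
end

section
/- As X → ∞, Q_1 := ∏_{p≤√X} (1 + 1/p) · ∏_{√X<p≤X} (1 + 1/(2p)) ~ (e^γ log X)/(√2 ζ(2)). -/
open Real Filter Finset

/-- The finset of primes `p` with `a < p ≤ X`. -/
noncomputable def primesBetween (a X : ℝ) : Finset ℕ :=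
  (Finset.range (⌊X⌋₊ + 1)).filter (fun p => p.Prime ∧ a < (p : ℝ) ∧ (p : ℝ) ≤ X)

lemma log_fact_eq (N : ℕ) : Real.log (N.factorial : ℝ) =
    ∑ p ∈ (range (N+1)).filter Nat.Prime, (N.factorial.factorization p : ℝ) * Real.log p := by
  rw [Real.log_nat_eq_sum_factorization, Finsupp.sum]
  apply Finset.sum_subset
  · intro p hp
    simp only [Nat.support_factorization, Nat.mem_primeFactors] at hp
    simp only [mem_filter, mem_range]
    exact ⟨Nat.lt_succ_of_le ((hp.1.dvd_factorial).1 hp.2.1), hp.1⟩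
  · intro p _ hp
    simp only [Finsupp.notMem_support_iff] at hp
    simp [hp]

lemma fact_val_lower {p : ℕ} (hp : p.Prime) (N : ℕ) :
    (N : ℝ) / p - 1 ≤ (N.factorial.factorization p : ℝ) := by
  have h1 : N / p ≤ N.factorial.factorization p := by
    have h : Nat.log p N < Nat.log p N + 2 := by omega
    rw [Nat.factorization_factorial hp h]
    have : (1:ℕ) ∈ Finset.Ico 1 (Nat.log p N + 2) := by simp
    have h2 := Finset.single_le_sum (f := fun i => N / p ^ i) (fun i _ => Nat.zero_le _) this
    simpa using h2
  have h2 : (N : ℝ) / p < ((N / p : ℕ) : ℝ) + 1 := by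
    rw [← Nat.floor_div_eq_div (K := ℝ)]
    exact Nat.lt_floor_add_one _
  have h3 : ((N / p : ℕ) : ℝ) ≤ (N.factorial.factorization p : ℝ) := by exact_mod_cast h1
  linarith

lemma fact_val_upper {p : ℕ} (hp : p.Prime) (N : ℕ) :
    (N.factorial.factorization p : ℝ) ≤ (N : ℝ) / ((p : ℝ) - 1) := by
  have h := Nat.sub_one_mul_factorization_factorial (n := N) hp
  have h1 : (p - 1) * N.factorial.factorization p ≤ N := by omega
  have h2 : (1:ℝ) < p := by exact_mod_cast hp.one_lt
  rw [le_div_iff₀ (by linarith)]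
  have h3 : (((p - 1) * N.factorial.factorization p : ℕ) : ℝ) ≤ N := by exact_mod_cast h1
  rw [Nat.cast_mul, Nat.cast_sub hp.one_lt.le] at h3
  push_cast at h3
  linarith

lemma log_fact_lower (N : ℕ) (hN : 1 ≤ N) : (N:ℝ) * Real.log N - N ≤ Real.log (N.factorial : ℝ) := by
  have h := Real.pow_div_factorial_le_exp (N:ℝ) (by positivity) N
  have hN' : (0:ℝ) < N := by exact_mod_cast hN
  have hf : (0:ℝ) < N.factorial := by exact_mod_cast N.factorial_pos
  have h2 := Real.log_le_log (by positivity) h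
  rw [Real.log_exp, Real.log_div (by positivity) (by positivity), Real.log_pow] at h2
  linarith

lemma log_fact_upper (N : ℕ) (_hN : 1 ≤ N) : Real.log (N.factorial : ℝ) ≤ (N:ℝ) * Real.log N := by
  have hf : (0:ℝ) < N.factorial := by exact_mod_cast N.factorial_pos
  have h2 : (N.factorial : ℝ) ≤ (N:ℝ)^N := by exact_mod_cast N.factorial_le_pow
  have h3 := Real.log_le_log hf h2
  rwa [Real.log_pow] at h3

noncomputable def mA (N : ℕ) : ℝ := ∑ p ∈ (range (N+1)).filter Nat.Prime, Real.log p / p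

lemma mA_upper (N : ℕ) (hN : 1 ≤ N) : mA N ≤ Real.log N + Real.log 4 := by
  have hN' : (0:ℝ) < N := by exact_mod_cast hN
  have h1 : (N:ℝ) * mA N - Chebyshev.theta N ≤ Real.log (N.factorial : ℝ) := by
    rw [log_fact_eq, Chebyshev.theta_eq_sum_primesLE_log, mA, Finset.mul_sum]
    change _ - ∑ p ∈ (range (N+1)).filter Nat.Prime, Real.log p ≤ _
    rw [← Finset.sum_sub_distrib]
    apply Finset.sum_le_sum
    intro p hp
    have hp' := (mem_filter.1 hp).2
    have := fact_val_lower hp' N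
    have hl : 0 ≤ Real.log p := Real.log_natCast_nonneg p
    calc _ = ((N:ℝ)/p - 1) * Real.log p := by ring
      _ ≤ _ := by gcongr
  have h2 := Chebyshev.theta_le_log4_mul_x hN'.le
  have h3 := log_fact_upper N hN
  have : (N:ℝ) * mA N ≤ N * (Real.log N + Real.log 4) := by linarith
  exact le_of_mul_le_mul_left this hN'

lemma summable_aux : Summable (fun n : ℕ => Real.log n / ((n:ℝ) * ((n:ℝ) - 1))) := by
  have h : Summable (fun n : ℕ => 4 * (1 / (n:ℝ)^(3/2:ℝ))) :=
    (Real.summable_one_div_nat_rpow.2 (by norm_num)).mul_left 4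
  apply Summable.of_norm_bounded h
  intro n
  rcases Nat.lt_or_ge n 2 with hn | hn
  · interval_cases n <;> simp
  have hn' : (2:ℝ) ≤ n := by exact_mod_cast hn
  have hl : 0 ≤ Real.log n := Real.log_natCast_nonneg n
  have h1 := Real.log_le_rpow_div (x := n) (ε := 1/2) (by positivity) (by norm_num)
  rw [Real.norm_of_nonneg (div_nonneg hl (by nlinarith))]
  have h3 : (n:ℝ)^(1/2:ℝ) * (n:ℝ)^(3/2:ℝ) = n^2 := by
    rw [← Real.rpow_add (by positivity)]; norm_num
  have hpos : (0:ℝ) < (n:ℝ)^(3/2:ℝ) := by positivity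
  rw [mul_one_div, div_le_div_iff₀ (by nlinarith) hpos]
  calc Real.log n * (n:ℝ)^(3/2:ℝ) ≤ ((n:ℝ)^(1/2:ℝ) / (1/2)) * (n:ℝ)^(3/2:ℝ) := by gcongr
    _ = 2 * n^2 := by rw [← h3]; ring
    _ ≤ _ := by nlinarith

lemma mA_lower : ∃ C : ℝ, ∀ N : ℕ, 1 ≤ N → Real.log N - C ≤ mA N := by
  refine ⟨1 + ∑' n : ℕ, Real.log n / ((n:ℝ) * ((n:ℝ) - 1)), fun N hN => ?_⟩
  have hN' : (0:ℝ) < N := by exact_mod_cast hN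
  have h1 : Real.log (N.factorial : ℝ) ≤
      N * ∑ p ∈ (range (N+1)).filter Nat.Prime, Real.log p / ((p:ℝ) - 1) := by
    rw [log_fact_eq, Finset.mul_sum]
    apply Finset.sum_le_sum
    intro p hp
    have hp' := (mem_filter.1 hp).2
    have := fact_val_upper hp' N
    have hl : 0 ≤ Real.log p := Real.log_natCast_nonneg p
    calc _ ≤ (N:ℝ)/((p:ℝ) - 1) * Real.log p := by gcongr
      _ = _ := by ring
  have h2 : ∑ p ∈ (range (N+1)).filter Nat.Prime, Real.log p / ((p:ℝ) - 1) =
      mA N + ∑ p ∈ (range (N+1)).filter Nat.Prime, Real.log p / ((p:ℝ) * ((p:ℝ) - 1)) := by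
    rw [mA, ← Finset.sum_add_distrib]
    apply Finset.sum_congr rfl
    intro p hp
    have hp' := (mem_filter.1 hp).2
    have h2 : (1:ℝ) < p := by exact_mod_cast hp'.one_lt
    have : (p:ℝ) - 1 ≠ 0 := by linarith
    have : (p:ℝ) ≠ 0 := by linarith
    field_simp
    ring
  have h3 : ∑ p ∈ (range (N+1)).filter Nat.Prime, Real.log p / ((p:ℝ) * ((p:ℝ) - 1)) ≤
      ∑' n : ℕ, Real.log n / ((n:ℝ) * ((n:ℝ) - 1)) := by
    apply summable_aux.sum_le_tsum
    intro n _
    rcases Nat.lt_or_ge n 2 with hn | hn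
    · interval_cases n <;> simp
    have hn' : (2:ℝ) ≤ n := by exact_mod_cast hn
    exact div_nonneg (Real.log_natCast_nonneg n) (by nlinarith)
  have h4 := log_fact_lower N hN
  rw [h2] at h1
  have : (N:ℝ) * (Real.log N - 1) ≤ N * (mA N + ∑' n : ℕ, Real.log n / ((n:ℝ) * ((n:ℝ) - 1))) := by
    refine le_trans (by linarith) (h1.trans ?_)
    gcongr
  have := le_of_mul_le_mul_left this hN'
  linarith

noncomputable def mP (N : ℕ) : ℝ := ∑ p ∈ (range (N+1)).filter Nat.Prime, 1 / (p:ℝ)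

lemma mP_succ (N : ℕ) : mP (N+1) = mP N + if (N+1).Prime then 1 / ((N+1 : ℕ):ℝ) else 0 := by
  simp only [mP, Finset.sum_filter]
  rw [Finset.sum_range_succ]

lemma mA_succ (N : ℕ) : mA (N+1) = mA N +
    if (N+1).Prime then Real.log ((N+1 : ℕ):ℝ) / ((N+1 : ℕ):ℝ) else 0 := by
  simp only [mA, Finset.sum_filter]
  rw [Finset.sum_range_succ]

lemma mA_one : mA 1 = 0 := by
  simp [mA, Finset.sum_filter, Finset.sum_range_succ]

lemma mP_one : mP 1 = 0 := by
  simp [mP, Finset.sum_filter, Finset.sum_range_succ, Nat.not_prime_one]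

noncomputable def mU (n : ℕ) : ℝ := Real.log (Real.log ((n:ℝ)+2)) -
    ∑ i ∈ range n, (Real.log ((i:ℝ)+3) - Real.log ((i:ℝ)+2)) / Real.log ((i:ℝ)+3)

lemma mU_step (n : ℕ) : 0 ≤ mU (n+1) - mU n ∧
    mU (n+1) - mU n ≤ 1 / Real.log ((n:ℝ)+2) - 1 / Real.log ((n:ℝ)+3) := by
  have e : mU (n+1) - mU n = Real.log (Real.log ((n:ℝ)+3)) - Real.log (Real.log ((n:ℝ)+2)) -
      (Real.log ((n:ℝ)+3) - Real.log ((n:ℝ)+2)) / Real.log ((n:ℝ)+3) := by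
    simp only [mU, Finset.sum_range_succ]
    push_cast
    rw [show (n:ℝ) + 1 + 2 = n + 3 by ring]
    ring
  rw [e]
  have hn : (0:ℝ) ≤ n := by positivity
  have ha : 0 < Real.log ((n:ℝ)+2) := Real.log_pos (by linarith)
  have hab : Real.log ((n:ℝ)+2) ≤ Real.log ((n:ℝ)+3) := Real.log_le_log (by linarith) (by linarith)
  have hba : Real.log ((n:ℝ)+3) - Real.log ((n:ℝ)+2) ≤ 1 := by
    rw [← Real.log_div (by linarith) (by linarith)]
    have := Real.log_le_sub_one_of_pos (x := ((n:ℝ)+3)/((n:ℝ)+2)) (by positivity)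
    have h2 : ((n:ℝ)+3)/((n:ℝ)+2) ≤ 2 := by
      rw [div_le_iff₀ (by linarith)]; linarith
    linarith
  generalize Real.log ((n:ℝ)+2) = a at *
  generalize Real.log ((n:ℝ)+3) = b at *
  have hb : 0 < b := by linarith
  rw [← Real.log_div hb.ne' ha.ne']
  have h1 := Real.one_sub_inv_le_log_of_pos (x := b / a) (by positivity)
  have h2 := Real.log_le_sub_one_of_pos (x := b / a) (by positivity)
  rw [inv_div] at h1
  have e1 : (b - a) / b = 1 - a / b := by field_simp
  constructor
  · linarith
  · have : (b - a) * (1/a - 1/b) ≤ 1 * (1/a - 1/b) := by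
      apply mul_le_mul_of_nonneg_right hba
      have := one_div_le_one_div_of_le ha hab
      linarith
    have e2 : (b - a) * (1/a - 1/b) = b / a - 1 - (1 - a / b) := by field_simp
    linarith

lemma mU_conv : ∃ L, Tendsto mU atTop (nhds L) := by
  have hm : Monotone mU := monotone_nat_of_le_succ (fun n => by linarith [(mU_step n).1])
  have hb : ∀ n : ℕ, mU n ≤ mU 0 + 1 / Real.log 2 - 1 / Real.log ((n:ℝ)+2) := by
    intro n
    induction n with
    | zero => simp
    | succ k ih =>
      have := (mU_step k).2
      push_cast
      rw [show (k:ℝ) + 1 + 2 = k + 3 by ring]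
      linarith
  refine ⟨_, tendsto_atTop_ciSup hm ⟨mU 0 + 1 / Real.log 2, ?_⟩⟩
  rintro _ ⟨n, rfl⟩
  have := hb n
  have h : 0 ≤ 1 / Real.log ((n:ℝ)+2) := by
    apply one_div_nonneg.2 (Real.log_nonneg _)
    have : (0:ℝ) ≤ n := by positivity
    linarith
  linarith

lemma mP_expr (n : ℕ) : mP (n+2) = ∑ i ∈ range (n+1), (1 / Real.log ((i:ℝ)+2)) *
      ((mA (i+2) - Real.log ((i:ℝ)+2)) - (mA (i+1) - Real.log ((i:ℝ)+1))) + 1 +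
    ∑ i ∈ range n, (Real.log ((i:ℝ)+3) - Real.log ((i:ℝ)+2)) / Real.log ((i:ℝ)+3) := by
  have key : ∀ n : ℕ, mP (n+2) = mP (n+1) + (1 / Real.log ((n:ℝ)+2)) *
      ((mA (n+2) - Real.log ((n:ℝ)+2)) - (mA (n+1) - Real.log ((n:ℝ)+1))) +
      (Real.log ((n:ℝ)+2) - Real.log ((n:ℝ)+1)) / Real.log ((n:ℝ)+2) := by
    intro n
    have hn : (0:ℝ) ≤ n := by positivity
    have ha : 0 < Real.log ((n:ℝ)+2) := Real.log_pos (by linarith)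
    rw [mP_succ (n+1), mA_succ (n+1)]
    have : ((n+1+1 : ℕ):ℝ) = n + 2 := by push_cast; ring
    rw [this]
    split_ifs
    · field_simp
      ring
    · field_simp
      ring
  induction n with
  | zero =>
    rw [key 0]
    have : Real.log 2 ≠ 0 := (Real.log_pos (by norm_num)).ne'
    simp [mP_one, mA_one, this]
  | succ k ih =>
    rw [key (k+1), show k + 1 + 1 = k + 2 by ring, ih, Finset.sum_range_succ _ (k+1), 
      Finset.sum_range_succ (fun i : ℕ => (Real.log ((i:ℝ)+3) - Real.log ((i:ℝ)+2)) / Real.log ((i:ℝ)+3)) k]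
    push_cast
    rw [show (k:ℝ) + 1 + 2 = k + 3 by ring, show (k:ℝ) + 1 + 1 = k + 2 by ring]
    ring

lemma mertens2_nat : ∃ M : ℝ, Tendsto (fun n : ℕ => mP n - Real.log (Real.log n)) atTop (nhds M) := by
  obtain ⟨L, hL⟩ := mU_conv
  obtain ⟨C, hC⟩ := mA_lower
  have hcs := Antitone.cauchySeq_series_mul_of_tendsto_zero_of_bounded (E := ℝ)
    (b := |C| + Real.log 4)
    (f := fun i : ℕ => 1 / Real.log ((i:ℝ)+2))
    (z := fun i : ℕ => (mA (i+2) - Real.log ((i:ℝ)+2)) - (mA (i+1) - Real.log ((i:ℝ)+1)))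
    (by
      intro i j hij
      have hi : (0:ℝ) ≤ i := by positivity
      have hij' : (i:ℝ) ≤ j := by exact_mod_cast hij
      apply one_div_le_one_div_of_le (Real.log_pos (by linarith))
      exact Real.log_le_log (by linarith) (by linarith))
    (by
      simp only [one_div]
      apply Tendsto.inv_tendsto_atTop
      apply Real.tendsto_log_atTop.comp
      exact tendsto_atTop_add_const_right _ _ tendsto_natCast_atTop_atTop)
    (by
      intro n
      have : ∑ i ∈ range n, ((mA (i+2) - Real.log ((i:ℝ)+2)) - (mA (i+1) - Real.log ((i:ℝ)+1)))
        = mA (n+1) - Real.log ((n+1 : ℕ):ℝ) := by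
        have := Finset.sum_range_sub (fun i : ℕ => mA (i+1) - Real.log ((i+1 : ℕ):ℝ)) n
        simp only [zero_add, mA_one, Nat.cast_one, Real.log_one, sub_zero] at this
        rw [← this]
        apply Finset.sum_congr rfl
        intro i _
        push_cast
        rw [show (i:ℝ) + 1 + 1 = i + 2 by ring]
      rw [this, Real.norm_eq_abs, abs_le]
      have h1 := mA_upper (n+1) (by omega)
      have h2 := hC (n+1) (by omega)
      have h3 := le_abs_self C
      have h4 := abs_nonneg C
      have h5 : 0 ≤ Real.log 4 := Real.log_nonneg (by norm_num)
      constructor <;> linarith)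
  obtain ⟨K, hK⟩ := cauchySeq_tendsto_of_complete hcs
  refine ⟨K + 1 - L, ?_⟩
  rw [← tendsto_add_atTop_iff_nat 2]
  have := ((hK.comp (tendsto_add_atTop_nat 1)).add_const 1).sub hL
  refine this.congr (fun n => ?_)
  rw [mP_expr]
  simp only [Function.comp, smul_eq_mul, mU]
  push_cast
  ring

/-- log of floor -/
lemma log_floor_sub : Tendsto (fun x : ℝ => Real.log (⌊x⌋₊ : ℝ) - Real.log x) atTop (nhds 0) := by
  have h := (tendsto_nat_floor_div_atTop (R := ℝ)).log (by norm_num)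
  rw [Real.log_one] at h
  refine h.congr' ?_
  filter_upwards [eventually_ge_atTop 1] with x hx
  have : 0 < ⌊x⌋₊ := Nat.floor_pos.2 hx
  rw [Real.log_div (by positivity) (by positivity)]

lemma loglog_floor_sub :
    Tendsto (fun x : ℝ => Real.log (Real.log (⌊x⌋₊ : ℝ)) - Real.log (Real.log x)) atTop (nhds 0) := by
  have h1 : Tendsto (fun x : ℝ => (Real.log (⌊x⌋₊ : ℝ) - Real.log x) / Real.log x + 1) atTop (nhds 1) := by
    have := (log_floor_sub.div_atTop Real.tendsto_log_atTop).add_const 1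
    simpa using this
  have h := h1.log (by norm_num)
  rw [Real.log_one] at h
  refine h.congr' ?_
  filter_upwards [eventually_ge_atTop 2] with x hx
  have h2 : 2 ≤ ⌊x⌋₊ := Nat.le_floor hx
  have h2' : (2:ℝ) ≤ (⌊x⌋₊ : ℝ) := by exact_mod_cast h2
  have ha : 0 < Real.log (⌊x⌋₊ : ℝ) := Real.log_pos (by linarith)
  have hb : 0 < Real.log x := Real.log_pos (by linarith)
  rw [← Real.log_div ha.ne' hb.ne']
  congr 1
  field_simp
  ring

lemma mertens2 {M : ℝ} (hM : Tendsto (fun n : ℕ => mP n - Real.log (Real.log n)) atTop (nhds M)) :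
    Tendsto (fun x : ℝ => mP ⌊x⌋₊ - Real.log (Real.log x)) atTop (nhds M) := by
  have := (hM.comp (tendsto_nat_floor_atTop (α := ℝ))).add loglog_floor_sub
  rw [add_zero] at this
  refine this.congr (fun x => ?_)
  simp only [Function.comp]
  ring

/-- indicator-of-primes version -/
noncomputable def pind (f : ℕ → ℝ) (n : ℕ) : ℝ := if n.Prime then f n else 0

lemma neg_log_bounds {x : ℝ} (h0 : 0 ≤ x) (h1 : x ≤ 1/2) :
    0 ≤ -Real.log (1 - x) - x ∧ -Real.log (1 - x) - x ≤ 2 * x^2 := by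
  have h2 := Real.log_le_sub_one_of_pos (x := 1 - x) (by linarith)
  have h3 := Real.one_sub_inv_le_log_of_pos (x := 1 - x) (by linarith)
  refine ⟨by linarith, ?_⟩
  have h4 : (1 - x)⁻¹ ≤ 1 + x + 2 * x^2 := by
    rw [inv_le_iff_one_le_mul₀ (by linarith)]
    nlinarith [mul_nonneg h0 h0, mul_nonneg (mul_nonneg h0 h0) (sub_nonneg.2 h1)]
  linarith

lemma prime_rpow_le {n : ℕ} (hn : n.Prime) {s : ℝ} (hs : 1 ≤ s) :
    0 < (n:ℝ)^(-s) ∧ (n:ℝ)^(-s) ≤ 1/(n:ℝ) ∧ (n:ℝ)^(-s) ≤ 1/2 := by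
  have h2 : (2:ℝ) ≤ n := by exact_mod_cast hn.two_le
  have h : (n:ℝ)^(-s) ≤ 1/(n:ℝ) := by
    rw [one_div, ← Real.rpow_neg_one]
    exact Real.rpow_le_rpow_of_exponent_le (by linarith) (by linarith)
  refine ⟨by positivity, h, h.trans ?_⟩
  exact one_div_le_one_div_of_le (by norm_num) h2

noncomputable def zterm (s : ℝ) (n : ℕ) : ℝ := pind (fun n => -Real.log (1 - (n:ℝ)^(-s))) n
noncomputable def rterm (s : ℝ) (n : ℕ) : ℝ := pind (fun n => (n:ℝ)^(-s)) n
noncomputable def eterm (s : ℝ) (n : ℕ) : ℝ := pind (fun n => -Real.log (1 - (n:ℝ)^(-s)) - (n:ℝ)^(-s)) n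

lemma eterm_bound {s : ℝ} (hs : 1 ≤ s) (n : ℕ) : ‖eterm s n‖ ≤ 2 * (1 / (n:ℝ)^2) := by
  rw [eterm, pind]
  split_ifs with hn
  · obtain ⟨h1, h2, h3⟩ := prime_rpow_le hn hs
    obtain ⟨h4, h5⟩ := neg_log_bounds h1.le h3
    rw [Real.norm_of_nonneg h4]
    refine h5.trans ?_
    rw [← one_div_pow]
    gcongr
  · simp

lemma summable_two : Summable (fun n : ℕ => 2 * (1 / (n:ℝ)^2)) :=
  (hasSum_zeta_two.summable).mul_left 2

lemma eterm_summable {s : ℝ} (hs : 1 ≤ s) : Summable (eterm s) :=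
  Summable.of_norm_bounded summable_two (eterm_bound hs)

lemma rterm_summable {s : ℝ} (hs : 1 < s) : Summable (rterm s) := by
  apply Summable.of_norm_bounded (Real.summable_nat_rpow.2 (show -s < -1 by linarith))
  intro n
  rw [rterm, pind]
  split_ifs
  · rw [Real.norm_of_nonneg (by positivity)]
  · rw [norm_zero]; positivity

lemma zterm_eq (s : ℝ) (n : ℕ) : zterm s n = eterm s n + rterm s n := by
  simp only [zterm, eterm, rterm, pind]
  split_ifs <;> ring

lemma zterm_hasSum {s : ℝ} (hs : 1 < s) : HasSum (zterm s) (Real.log (∑' n : ℕ, 1 / (n:ℝ)^s)) := by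
  have hsum : Summable (zterm s) := by
    simp_rw [funext (zterm_eq s)]
    exact (eterm_summable hs.le).add (rterm_summable hs)
  let f : ℕ →*₀ ℝ :=
    { toFun := fun n => (n:ℝ)^(-s)
      map_zero' := by
        simp only [Nat.cast_zero]
        exact Real.zero_rpow (by linarith)
      map_one' := by simp
      map_mul' := fun a b => by
        push_cast
        exact Real.mul_rpow (by positivity) (by positivity) }
  have hf : ∀ n, f n = (n:ℝ)^(-s) := fun n => rfl
  have hfs : Summable (fun n : ℕ => (n:ℝ)^(-s)) := Real.summable_nat_rpow.2 (by linarith)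
  have h := EulerProduct.eulerProduct_completely_multiplicative (f := f) (by
    simp only [hf]
    exact hfs.norm)
  have e : ∑' n, f n = ∑' n : ℕ, 1 / (n:ℝ)^s := by
    apply tsum_congr
    intro n
    rw [hf, Real.rpow_neg (by positivity), one_div]
  rw [e] at h
  have hpos : 0 < ∑' n : ℕ, 1 / (n:ℝ)^s := by
    rw [← e]
    simp only [hf]
    exact hfs.tsum_pos (fun n => by positivity) 1 (by simp)
  have h2 := h.log hpos.ne'
  have h3 := hsum.hasSum.tendsto_sum_nat
  have h4 : (fun n : ℕ => Real.log (∏ p ∈ n.primesBelow, (1 - f p)⁻¹)) =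
      fun n => ∑ i ∈ range n, zterm s i := by
    ext n
    rw [Real.log_prod]
    · simp only [Nat.primesBelow, Finset.sum_filter, zterm, pind, hf, Real.log_inv]
    · intro p hp
      have hp' := Nat.prime_of_mem_primesBelow hp
      obtain ⟨h1, h2, h3⟩ := prime_rpow_le hp' hs.le
      apply inv_ne_zero
      rw [hf]
      linarith
  rw [h4] at h2
  rw [tendsto_nhds_unique h2 h3]
  exact hsum.hasSum

lemma eterm_tendsto : Tendsto (fun δ : ℝ => ∑' n, eterm (1+δ) n) (nhdsWithin 0 (Set.Ioi 0))
    (nhds (∑' n, eterm 1 n)) := by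
  apply tendsto_tsum_of_dominated_convergence summable_two
  · intro n
    apply tendsto_nhdsWithin_of_tendsto_nhds
    have : ContinuousAt (fun δ : ℝ => eterm (1+δ) n) 0 := by
      simp only [eterm, pind]
      split_ifs with hn
      · have hn0 : (n:ℝ) ≠ 0 := by exact_mod_cast hn.ne_zero
        have h1 : ContinuousAt (fun δ : ℝ => (n:ℝ)^(-(1+δ))) 0 := by
          apply ContinuousAt.rpow (by fun_prop) (by fun_prop)
          left; exact hn0
        refine ((ContinuousAt.log (continuousAt_const.sub h1) ?_).neg).sub h1
        have := (prime_rpow_le hn (s := 1 + 0) (by norm_num)).2.2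
        have h5 : ∀ y : ℝ, y ≤ 1/2 → 1 - y ≠ 0 := by
          intro y hy
          linarith
        exact h5 _ this
      · exact continuousAt_const
    have h := this.tendsto
    simpa using h
  · filter_upwards [self_mem_nhdsWithin] with δ hδ n
    exact eterm_bound (by linarith [Set.mem_Ioi.1 hδ]) n

lemma rterm_tendsto : Tendsto (fun δ : ℝ => ∑' n, rterm (1+δ) n + Real.log δ)
    (nhdsWithin 0 (Set.Ioi 0)) (nhds (-∑' n, eterm 1 n)) := by
  have h1 : Tendsto (fun δ : ℝ => 1 + δ) (nhdsWithin 0 (Set.Ioi 0)) (nhdsWithin 1 (Set.Ioi 1)) := by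
    apply tendsto_nhdsWithin_of_tendsto_nhds_of_eventually_within
    · apply tendsto_nhdsWithin_of_tendsto_nhds
      have : Continuous (fun δ : ℝ => 1 + δ) := by fun_prop
      simpa using this.tendsto 0
    · filter_upwards [self_mem_nhdsWithin] with δ hδ
      have : 0 < δ := hδ
      simpa using this
  have h2 := (tendsto_sub_mul_tsum_nat_rpow.comp h1).log (by norm_num)
  rw [Real.log_one] at h2
  have h3 := h2.sub eterm_tendsto
  rw [zero_sub] at h3
  refine h3.congr' ?_
  filter_upwards [self_mem_nhdsWithin] with δ hδ
  have hδ : 0 < δ := hδ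
  have hs : 1 < 1 + δ := by linarith
  have hz := zterm_hasSum hs
  have hz2 := ((eterm_summable hs.le).hasSum).add (rterm_summable hs).hasSum
  have := (hz.congr_fun (fun n => (zterm_eq _ n).symm)).unique hz2
  have hpos : ∑' n : ℕ, 1 / (n:ℝ)^(1+δ) ≠ 0 := by
    have : 0 < ∑' n : ℕ, 1 / (n:ℝ)^(1+δ) :=
      (Real.summable_one_div_nat_rpow.2 hs).tsum_pos (fun n => by positivity) 1 (by simp)
    exact this.ne'
  simp only [Function.comp]
  rw [add_sub_cancel_left, Real.log_mul hδ.ne' hpos]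
  linarith

lemma one_int {δ : ℝ} (hδ : 0 < δ) {l : ℝ} (hl : 0 < l) (c : ℝ) :
    MeasureTheory.IntegrableOn (fun v : ℝ => Real.exp (-v) * (if l ≤ v / δ then c else 0)) (Set.Ioi 0) ∧
    ∫ v in Set.Ioi (0:ℝ), Real.exp (-v) * (if l ≤ v / δ then c else 0) = c * Real.exp (-(δ * l)) := by
  have hfun : (fun v : ℝ => Real.exp (-v) * (if l ≤ v / δ then c else 0)) =
      (Set.Ici (δ * l)).indicator (fun v => c * Real.exp (-v)) := by
    ext v
    have : l ≤ v / δ ↔ v ∈ Set.Ici (δ * l) := by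
      rw [le_div_iff₀ hδ, Set.mem_Ici, mul_comm]
    by_cases h : l ≤ v / δ
    · rw [if_pos h, Set.indicator_of_mem (this.1 h), mul_comm]
    · rw [if_neg h, Set.indicator_of_notMem (fun h' => h (this.2 h')), mul_zero]
  rw [hfun]
  have hi : MeasureTheory.IntegrableOn (fun v : ℝ => c * Real.exp (-v)) (Set.Ioi 0) :=
    (integrableOn_exp_neg_Ioi 0).const_mul c
  refine ⟨hi.indicator measurableSet_Ici, ?_⟩
  rw [MeasureTheory.setIntegral_indicator measurableSet_Ici]
  have : Set.Ioi (0:ℝ) ∩ Set.Ici (δ * l) = Set.Ici (δ * l) := by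
    apply Set.inter_eq_right.2
    intro v hv
    have : 0 < δ * l := by positivity
    exact lt_of_lt_of_le this hv
  rw [this, MeasureTheory.integral_Ici_eq_integral_Ioi, MeasureTheory.integral_const_mul,
    integral_exp_neg_Ioi]

noncomputable def mH (N : ℕ) : ℝ := ∑ n ∈ range (N+1), 1 / (n:ℝ)

lemma mH_eq (N : ℕ) : mH N = (harmonic N : ℝ) := by
  rw [mH, Finset.sum_range_succ', harmonic]
  simp

noncomputable def mg (u : ℝ) : ℝ := mP ⌊Real.exp u⌋₊ - mH ⌊u⌋₊

lemma mP_mono : Monotone mP := by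
  apply monotone_nat_of_le_succ
  intro n
  rw [mP_succ]
  split_ifs
  · have : 0 ≤ 1 / ((n+1 : ℕ):ℝ) := by positivity
    linarith
  · simp

lemma mH_mono : Monotone mH := by
  apply monotone_nat_of_le_succ
  intro n
  simp only [mH]
  rw [Finset.sum_range_succ _ (n+1)]
  have : 0 ≤ 1 / ((n+1 : ℕ):ℝ) := by positivity
  linarith

lemma mg_meas : Measurable mg := by
  apply Measurable.sub
  · apply Monotone.measurable
    intro x y h
    exact mP_mono (Nat.floor_mono (Real.exp_le_exp.2 h))
  · apply Monotone.measurable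
    intro x y h
    exact mH_mono (Nat.floor_mono h)

lemma mg_tendsto {M : ℝ} (hM : Tendsto (fun n : ℕ => mP n - Real.log (Real.log n)) atTop (nhds M)) :
    Tendsto mg atTop (nhds (M - Real.eulerMascheroniConstant)) := by
  have h1 := (mertens2 hM).comp Real.tendsto_exp_atTop
  have h2 := Real.tendsto_harmonic_sub_log.comp (tendsto_nat_floor_atTop (α := ℝ))
  have h3 := (h1.sub h2).sub log_floor_sub
  rw [sub_zero] at h3
  refine h3.congr (fun x => ?_)
  simp only [Function.comp, mg, mH_eq, Real.log_exp]
  ring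

lemma mg_bdd {L : ℝ} (h : Tendsto mg atTop (nhds L)) : ∃ C, ∀ u, |mg u| ≤ C := by
  have h1 := h.abs.eventually (eventually_le_nhds (show |L| < |L| + 1 by linarith))
  obtain ⟨U, hU⟩ := eventually_atTop.1 h1
  refine ⟨max (|L| + 1) (mP ⌊Real.exp U⌋₊ + mH ⌊U⌋₊), fun u => ?_⟩
  rcases le_total U u with hu | hu
  · exact (hU u hu).trans (le_max_left _ _)
  · refine le_trans ?_ (le_max_right _ _)
    have a1 : mP ⌊Real.exp u⌋₊ ≤ mP ⌊Real.exp U⌋₊ := mP_mono (Nat.floor_mono (Real.exp_le_exp.2 hu))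
    have a2 : mH ⌊u⌋₊ ≤ mH ⌊U⌋₊ := mH_mono (Nat.floor_mono hu)
    have a3 : 0 ≤ mP ⌊Real.exp u⌋₊ := Finset.sum_nonneg (fun i _ => by positivity)
    have a4 : 0 ≤ mH ⌊u⌋₊ := Finset.sum_nonneg (fun i _ => by positivity)
    rw [mg, abs_le]
    constructor <;> linarith

lemma abel_int {L : ℝ} (h : Tendsto mg atTop (nhds L)) :
    Tendsto (fun δ : ℝ => ∫ v in Set.Ioi (0:ℝ), Real.exp (-v) * mg (v / δ))
      (nhdsWithin 0 (Set.Ioi 0)) (nhds L) := by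
  obtain ⟨C, hC⟩ := mg_bdd h
  have e : L = ∫ v in Set.Ioi (0:ℝ), Real.exp (-v) * L := by
    rw [MeasureTheory.integral_mul_const, integral_exp_neg_Ioi]
    simp
  rw [e]
  apply MeasureTheory.tendsto_integral_filter_of_dominated_convergence (fun v => Real.exp (-v) * C)
  · refine Eventually.of_forall (fun δ => ?_)
    apply Measurable.aestronglyMeasurable
    exact (by fun_prop : Measurable (fun v : ℝ => Real.exp (-v))).mul
      (mg_meas.comp (measurable_id.div_const δ))
  · refine Eventually.of_forall (fun δ => Eventually.of_forall (fun v => ?_))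
    rw [norm_mul, Real.norm_eq_abs, Real.norm_eq_abs, abs_of_pos (Real.exp_pos _)]
    gcongr
    exact hC _
  · exact (integrableOn_exp_neg_Ioi 0).mul_const C
  · filter_upwards [MeasureTheory.ae_restrict_mem measurableSet_Ioi] with v hv
    apply Tendsto.const_mul
    apply h.comp
    have hv : 0 < v := hv
    change Tendsto (fun δ : ℝ => v / δ) _ _
    simp only [div_eq_mul_inv]
    exact Tendsto.const_mul_atTop hv tendsto_inv_nhdsGT_zero

lemma exp_sum {δ : ℝ} (hδ : 0 < δ) :
    HasSum (fun n : ℕ => 1 / (n:ℝ) * Real.exp (-(δ * n))) (-Real.log (1 - Real.exp (-δ))) := by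
  have h := Real.hasSum_pow_div_log_of_abs_lt_one (x := Real.exp (-δ))
    (by rw [abs_of_pos (Real.exp_pos _)]; simpa using hδ)
  rw [← hasSum_nat_add_iff' 1]
  simp only [Finset.sum_range_one, Nat.cast_zero, div_zero, zero_mul, sub_zero]
  refine h.congr_fun (fun n => ?_)
  rw [← Real.exp_nat_mul]
  push_cast
  rw [show ((n:ℝ)+1) * -δ = -(δ * (n+1)) by ring]
  ring

lemma tsum_mg {u : ℝ} (hu : 0 < u) :
    HasSum (fun n : ℕ => (if Real.log n ≤ u then rterm 1 n else 0) -
      (if (n:ℝ) ≤ u then 1 / (n:ℝ) else 0)) (mg u) := by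
  apply HasSum.sub
  · have : mP ⌊Real.exp u⌋₊ = ∑ n ∈ range (⌊Real.exp u⌋₊ + 1),
        (if Real.log n ≤ u then rterm 1 n else 0) := by
      rw [mP, Finset.sum_filter]
      apply Finset.sum_congr rfl
      intro n hn
      have hn' : n ≤ ⌊Real.exp u⌋₊ := Nat.lt_succ_iff.1 (mem_range.1 hn)
      simp only [rterm, pind]
      split_ifs with h1 h2 h2
      · rw [Real.rpow_neg_one, one_div]
      · exfalso
        apply h2
        have h0 : (0:ℝ) < n := by exact_mod_cast h1.pos
        rw [Real.log_le_iff_le_exp h0]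
        exact (Nat.le_floor_iff (Real.exp_pos _).le).1 hn'
      · rfl
      · rfl
    rw [this]
    apply hasSum_sum_of_ne_finset_zero
    intro n hn
    have hn' : ⌊Real.exp u⌋₊ < n := by
      simp only [mem_range] at hn; omega
    rw [if_neg]
    have h0 : (0:ℝ) < n := by exact_mod_cast (Nat.zero_le _).trans_lt hn'
    rw [Real.log_le_iff_le_exp h0, not_le]
    exact (Nat.floor_lt (Real.exp_pos _).le).1 hn'
  · have : mH ⌊u⌋₊ = ∑ n ∈ range (⌊u⌋₊ + 1), (if (n:ℝ) ≤ u then 1 / (n:ℝ) else 0) := by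
      rw [mH]
      apply Finset.sum_congr rfl
      intro n hn
      have hn' : n ≤ ⌊u⌋₊ := Nat.lt_succ_iff.1 (mem_range.1 hn)
      rw [if_pos ((Nat.le_floor_iff hu.le).1 hn')]
    rw [this]
    apply hasSum_sum_of_ne_finset_zero
    intro n hn
    have hn' : ⌊u⌋₊ < n := by
      simp only [mem_range] at hn; omega
    rw [if_neg]
    rw [not_le]
    exact (Nat.floor_lt hu.le).1 hn'

lemma intA {δ : ℝ} (hδ : 0 < δ) (n : ℕ) :
    MeasureTheory.IntegrableOn (fun v : ℝ => Real.exp (-v) * (if Real.log n ≤ v / δ then rterm 1 n else 0)) (Set.Ioi 0) ∧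
    ∫ v in Set.Ioi (0:ℝ), Real.exp (-v) * (if Real.log n ≤ v / δ then rterm 1 n else 0) = rterm (1+δ) n := by
  by_cases hn : n.Prime
  · have h1 : (1:ℝ) < n := by exact_mod_cast hn.one_lt
    have := one_int hδ (Real.log_pos h1) (rterm 1 n)
    refine ⟨this.1, this.2.trans ?_⟩
    simp only [rterm, pind, if_pos hn]
    rw [neg_add, Real.rpow_add (by linarith), Real.rpow_def_of_pos (by linarith) (-δ)]
    congr 2
    ring
  · have : ∀ s, rterm s n = 0 := fun s => by simp [rterm, pind, hn]
    simp [this]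

lemma intB {δ : ℝ} (hδ : 0 < δ) (n : ℕ) :
    MeasureTheory.IntegrableOn (fun v : ℝ => Real.exp (-v) * (if (n:ℝ) ≤ v / δ then 1 / (n:ℝ) else 0)) (Set.Ioi 0) ∧
    ∫ v in Set.Ioi (0:ℝ), Real.exp (-v) * (if (n:ℝ) ≤ v / δ then 1 / (n:ℝ) else 0) =
      1 / (n:ℝ) * Real.exp (-(δ * n)) := by
  rcases Nat.eq_zero_or_pos n with rfl | hn
  · simp
  · exact one_int hδ (by exact_mod_cast hn) _

lemma rterm_nonneg (s : ℝ) (n : ℕ) : 0 ≤ rterm s n := by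
  simp only [rterm, pind]
  split_ifs <;> positivity

lemma abel_eq {δ : ℝ} (hδ : 0 < δ) : ∫ v in Set.Ioi (0:ℝ), Real.exp (-v) * mg (v / δ) =
    ∑' n, rterm (1+δ) n + Real.log (1 - Real.exp (-δ)) := by
  have hr := (rterm_summable (show 1 < 1 + δ by linarith)).hasSum
  have he := exp_sum hδ
  have h := MeasureTheory.hasSum_integral_of_summable_integral_norm
    (μ := MeasureTheory.volume.restrict (Set.Ioi (0:ℝ)))
    (F := fun (n : ℕ) (v : ℝ) => Real.exp (-v) * (if Real.log n ≤ v / δ then rterm 1 n else 0) -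
      Real.exp (-v) * (if (n:ℝ) ≤ v / δ then 1 / (n:ℝ) else 0))
    (fun n => (intA hδ n).1.sub (intB hδ n).1) (by
      refine Summable.of_nonneg_of_le (fun n => MeasureTheory.integral_nonneg (fun v => norm_nonneg _))
        (fun n => ?_) (hr.add he).summable
      rw [← (intA hδ n).2, ← (intB hδ n).2, ← MeasureTheory.integral_add (intA hδ n).1 (intB hδ n).1]
      apply MeasureTheory.integral_mono ((intA hδ n).1.sub (intB hδ n).1).norm
        ((intA hδ n).1.add (intB hδ n).1)
      intro v
      refine (norm_sub_le _ _).trans ?_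
      have b1 : 0 ≤ Real.exp (-v) * (if Real.log n ≤ v / δ then rterm 1 n else 0) := by
        apply mul_nonneg (Real.exp_pos _).le
        split_ifs
        · exact rterm_nonneg _ _
        · rfl
      have b2 : 0 ≤ Real.exp (-v) * (if (n:ℝ) ≤ v / δ then 1 / (n:ℝ) else 0) := by
        apply mul_nonneg (Real.exp_pos _).le
        split_ifs <;> positivity
      exact (congrArg₂ (· + ·) (Real.norm_of_nonneg b1) (Real.norm_of_nonneg b2)).le)
  have h2 : HasSum (fun n : ℕ => rterm (1+δ) n - 1 / (n:ℝ) * Real.exp (-(δ * n)))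
      (∫ v in Set.Ioi (0:ℝ), Real.exp (-v) * mg (v / δ)) := by
    have eA : (fun n : ℕ => rterm (1+δ) n - 1 / (n:ℝ) * Real.exp (-(δ * n))) = fun n : ℕ =>
        ∫ v in Set.Ioi (0:ℝ), (Real.exp (-v) * (if Real.log n ≤ v / δ then rterm 1 n else 0) -
          Real.exp (-v) * (if (n:ℝ) ≤ v / δ then 1 / (n:ℝ) else 0)) := by
      ext n
      rw [MeasureTheory.integral_sub (intA hδ n).1 (intB hδ n).1, (intA hδ n).2, (intB hδ n).2]
    rw [eA]
    refine (congrArg (HasSum _) ?_).mpr h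
    apply MeasureTheory.setIntegral_congr_fun measurableSet_Ioi
    intro v hv
    have hv : 0 < v := hv
    simp only [← mul_sub]
    exact (((tsum_mg (show 0 < v / δ by positivity)).mul_left (Real.exp (-v))).tsum_eq).symm
  rw [h2.unique (hr.sub he)]
  ring

lemma exp_ratio : Tendsto (fun δ : ℝ => Real.log (1 - Real.exp (-δ)) - Real.log δ)
    (nhdsWithin 0 (Set.Ioi 0)) (nhds 0) := by
  have hd : HasDerivAt (fun δ : ℝ => 1 - Real.exp (-δ)) 1 0 := by
    have := ((hasDerivAt_neg (0:ℝ)).exp).const_sub 1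
    simpa using this
  have h := (hasDerivAt_iff_tendsto_slope.1 hd).mono_left
    (nhdsWithin_mono 0 (fun x (hx : x ∈ Set.Ioi (0:ℝ)) => (ne_of_gt hx : x ≠ 0)))
  have h2 := h.log (by norm_num)
  rw [Real.log_one] at h2
  refine h2.congr' ?_
  filter_upwards [self_mem_nhdsWithin] with δ hδ
  have hδ : 0 < δ := hδ
  have : Real.exp (-δ) < 1 := by simpa using hδ
  rw [slope_def_field, ← Real.log_div (by linarith) hδ.ne']
  simp

lemma mertens_const {M : ℝ} (hM : Tendsto (fun n : ℕ => mP n - Real.log (Real.log n)) atTop (nhds M)) :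
    M = Real.eulerMascheroniConstant - ∑' n, eterm 1 n := by
  have h1 := abel_int (mg_tendsto hM)
  have h2 := rterm_tendsto.add exp_ratio
  have h3 : Tendsto (fun δ : ℝ => ∫ v in Set.Ioi (0:ℝ), Real.exp (-v) * mg (v / δ))
      (nhdsWithin 0 (Set.Ioi 0)) (nhds (-∑' n, eterm 1 n + 0)) := by
    refine h2.congr' ?_
    filter_upwards [self_mem_nhdsWithin] with δ hδ
    rw [abel_eq hδ]
    ring
  have := tendsto_nhds_unique h1 h3
  linarith

/-- generic: finite sums over primes of `log (1 + c/p)` minus `c/p` converge. -/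
noncomputable def dterm (c : ℝ) (n : ℕ) : ℝ := pind (fun n => Real.log (1 + c / (n:ℝ)) - c / (n:ℝ)) n

lemma dterm_summable {c : ℝ} (h0 : 0 ≤ c) (h1 : c ≤ 1) : Summable (dterm c) := by
  apply Summable.of_norm_bounded hasSum_zeta_two.summable
  intro n
  rw [dterm, pind]
  split_ifs with hn
  · have hn0 : (0:ℝ) < n := by exact_mod_cast hn.pos
    have hx : 0 ≤ c / (n:ℝ) := by positivity
    have hx1 : c / (n:ℝ) ≤ 1 / n := by gcongr
    rw [← one_div_pow]
    generalize c / (n:ℝ) = x at *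
    have h2 := Real.log_le_sub_one_of_pos (x := 1 + x) (by linarith)
    have h3 := Real.one_sub_inv_le_log_of_pos (x := 1 + x) (by linarith)
    have h4 : (1 + x)⁻¹ ≤ 1 - x + x^2 := by
      rw [inv_le_iff_one_le_mul₀ (by linarith)]
      nlinarith [mul_nonneg hx (mul_nonneg hx hx)]
    have h5 : x^2 ≤ (1 / (n:ℝ))^2 := by gcongr
    rw [Real.norm_eq_abs, abs_le]
    constructor <;> nlinarith
  · simp

lemma sum_log_prime {c : ℝ} (h0 : 0 ≤ c) (N : ℕ) :
    Real.log (∏ p ∈ (range (N+1)).filter Nat.Prime, (1 + c / (p:ℝ))) =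
      c * mP N + ∑ i ∈ range (N+1), dterm c i := by
  rw [Real.log_prod (fun p _ => by positivity), mP, Finset.mul_sum, Finset.sum_filter,
    Finset.sum_filter, ← Finset.sum_add_distrib]
  apply Finset.sum_congr rfl
  intro n _
  simp only [dterm, pind]
  split_ifs <;> ring

lemma dterm_tendsto {c : ℝ} (h0 : 0 ≤ c) (h1 : c ≤ 1) :
    Tendsto (fun N : ℕ => ∑ i ∈ range (N+1), dterm c i) atTop (nhds (∑' n, dterm c n)) :=
  ((dterm_summable h0 h1).hasSum.tendsto_sum_nat).comp (tendsto_add_atTop_nat 1)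

lemma const_eq : ∑' n, dterm 1 n - ∑' n, eterm 1 n = -Real.log (π^2/6) := by
  have hz := zterm_hasSum (s := 2) (by norm_num)
  have e : ∑' n : ℕ, 1 / (n:ℝ)^(2:ℝ) = π^2/6 := by
    rw [← hasSum_zeta_two.tsum_eq]
    apply tsum_congr
    intro n
    norm_num
  rw [e] at hz
  have h2 := (dterm_summable (c := 1) (by norm_num) le_rfl).hasSum.sub
    (eterm_summable (s := 1) le_rfl).hasSum
  refine h2.unique (hz.neg.congr_fun (fun n => ?_))
  simp only [dterm, eterm, zterm, pind]
  split_ifs with hn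
  · have h1 : (1:ℝ) < n := by exact_mod_cast hn.one_lt
    have hx : (n:ℝ)^(-1:ℝ) = 1 / n := by rw [Real.rpow_neg_one, one_div]
    have hx2 : (n:ℝ)^(-2:ℝ) = (1 / n)^2 := by
      rw [Real.rpow_neg (by linarith), one_div, inv_pow]; norm_num
    rw [hx, hx2]
    have h3 : 1 / (n:ℝ) < 1 := by rw [div_lt_one (by linarith)]; exact h1
    have h4 : 0 < 1 / (n:ℝ) := by positivity
    generalize 1 / (n:ℝ) = x at *
    rw [show 1 - x^2 = (1 + x) * (1 - x) by ring, Real.log_mul (by linarith) (by linarith)]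
    ring
  · simp

lemma primesBetween_one (Y : ℝ) : primesBetween 1 Y = (range (⌊Y⌋₊+1)).filter Nat.Prime := by
  ext p
  simp only [primesBetween, mem_filter, mem_range]
  constructor
  · rintro ⟨h, hp, _⟩
    exact ⟨h, hp⟩
  · rintro ⟨h, hp⟩
    refine ⟨h, hp, by exact_mod_cast hp.one_lt, ?_⟩
    exact (Nat.le_floor_iff' hp.ne_zero).1 (Nat.lt_succ_iff.1 h)

lemma prod_split {Y X : ℝ} (h0 : 0 ≤ Y) (h : Y ≤ X) (f : ℕ → ℝ) :
    (∏ p ∈ (range (⌊Y⌋₊+1)).filter Nat.Prime, f p) * ∏ p ∈ primesBetween Y X, f p =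
      ∏ p ∈ (range (⌊X⌋₊+1)).filter Nat.Prime, f p := by
  have hYX := Nat.floor_mono h
  rw [← Finset.prod_union]
  · apply Finset.prod_congr _ (fun _ _ => rfl)
    ext p
    simp only [primesBetween, mem_union, mem_filter, mem_range]
    constructor
    · rintro (⟨h1, h2⟩ | ⟨h1, h2, _⟩)
      · exact ⟨by omega, h2⟩
      · exact ⟨h1, h2⟩
    · rintro ⟨h1, h2⟩
      by_cases h3 : p < ⌊Y⌋₊ + 1
      · exact Or.inl ⟨h3, h2⟩
      · refine Or.inr ⟨h1, h2, ?_, ?_⟩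
        · exact (Nat.floor_lt h0).1 (by omega)
        · exact (Nat.le_floor_iff' h2.ne_zero).1 (Nat.lt_succ_iff.1 h1)
  · rw [Finset.disjoint_left]
    intro p hp hp2
    simp only [primesBetween, mem_filter, mem_range] at hp hp2
    have := (Nat.le_floor_iff h0).1 (Nat.lt_succ_iff.1 hp.1)
    linarith [hp2.2.2.1]

/-- As `X → ∞`,
`Q₁ := ∏_{p ≤ √X} (1 + 1/p) · ∏_{√X < p ≤ X} (1 + 1/(2p))
     ~ e^γ log X / (√2 ζ(2))`,
with `γ` Euler's constant and `ζ(2) = π²/6`. -/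
theorem Q1_asymptotic :
    Tendsto (fun X : ℝ =>
        ((∏ p ∈ primesBetween 1 (Real.sqrt X), (1 + 1 / (p : ℝ))) *
            ∏ p ∈ primesBetween (Real.sqrt X) X, (1 + 1 / (2 * (p : ℝ))))
          / (Real.exp Real.eulerMascheroniConstant * Real.log X
              / (Real.sqrt 2 * (π ^ 2 / 6))))
      atTop (nhds 1) := by
  obtain ⟨M, hM⟩ := mertens2_nat
  have hMc := mertens_const hM
  have h2 := mertens2 hM
  have hs : Tendsto (fun X : ℝ => Real.sqrt X) atTop atTop := Real.tendsto_sqrt_atTop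
  have hfl := tendsto_nat_floor_atTop (α := ℝ)
  have h2s := h2.comp hs
  have d1 := (dterm_tendsto (c := 1) (by norm_num) le_rfl).comp (hfl.comp hs)
  have d2 := (dterm_tendsto (c := 1/2) (by norm_num) (by norm_num)).comp hfl
  have d3 := (dterm_tendsto (c := 1/2) (by norm_num) (by norm_num)).comp (hfl.comp hs)
  -- the logarithm of the quotient
  have key := ((h2s.add d1).add ((h2.sub h2s).const_mul (1/2))).add (d2.sub d3)
  have key2 := (key.add_const (-Real.log 2 + 1/2 * Real.log 2 - Real.eulerMascheroniConstant
    + Real.log (Real.sqrt 2) + Real.log (π^2/6))).rexp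
  have hl2 : Real.log (Real.sqrt 2) = Real.log 2 / 2 := Real.log_sqrt (by norm_num)
  have e1 : M + ∑' n, dterm 1 n + 1/2 * (M - M) + (∑' n, dterm (1/2) n - ∑' n, dterm (1/2) n) +
      (-Real.log 2 + 1/2 * Real.log 2 - Real.eulerMascheroniConstant
    + Real.log (Real.sqrt 2) + Real.log (π^2/6)) = 0 := by
    have := const_eq
    rw [hl2]
    linarith
  rw [e1, Real.exp_zero] at key2
  refine key2.congr' ?_
  filter_upwards [eventually_ge_atTop 4] with X hX
  have hX0 : 0 ≤ X := by linarith
  have hsX : Real.sqrt X ≤ X := by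
    rw [Real.sqrt_le_left hX0]
    nlinarith
  have hlX : 0 < Real.log X := Real.log_pos (by linarith)
  have hc : ∀ p : ℕ, 1 + 1 / (2 * (p:ℝ)) = 1 + (1/2) / (p:ℝ) := by
    intro p
    rw [div_div]
  simp only [hc, primesBetween_one]
  set A := ∏ p ∈ (range (⌊Real.sqrt X⌋₊+1)).filter Nat.Prime, (1 + 1 / (p:ℝ)) with hA
  set B := ∏ p ∈ primesBetween (Real.sqrt X) X, (1 + (1/2) / (p:ℝ)) with hB
  have hApos : 0 < A := Finset.prod_pos (fun p _ => by positivity)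
  have hBpos : 0 < B := Finset.prod_pos (fun p _ => by positivity)
  have lA := sum_log_prime (c := 1) (by norm_num) ⌊Real.sqrt X⌋₊
  rw [← hA] at lA
  have hsp := prod_split (Real.sqrt_nonneg X) hsX (fun p => 1 + (1/2) / (p:ℝ))
  simp only [← hB] at hsp
  have hCpos : 0 < ∏ p ∈ (range (⌊Real.sqrt X⌋₊+1)).filter Nat.Prime, (1 + (1/2) / (p:ℝ)) :=
    Finset.prod_pos (fun p _ => by positivity)
  have lsp := congrArg Real.log hsp
  rw [Real.log_mul hCpos.ne' hBpos.ne', sum_log_prime (c := 1/2) (by norm_num),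
    sum_log_prime (c := 1/2) (by norm_num)] at lsp
  have hlls : Real.log (Real.log (Real.sqrt X)) = Real.log (Real.log X) - Real.log 2 := by
    rw [Real.log_sqrt hX0, Real.log_div hlX.ne' (by norm_num)]
  have hs2 : 0 < Real.sqrt 2 := by positivity
  have hpi : 0 < π^2/6 := by positivity
  rw [← Real.exp_log (show 0 < A * B / (Real.exp Real.eulerMascheroniConstant * Real.log X
              / (Real.sqrt 2 * (π ^ 2 / 6))) by positivity)]
  congr 1
  have hlog : Real.log (A * B / (Real.exp Real.eulerMascheroniConstant * Real.log X
              / (Real.sqrt 2 * (π ^ 2 / 6)))) = Real.log A + Real.log B -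
      (Real.eulerMascheroniConstant + Real.log (Real.log X) -
        (Real.log (Real.sqrt 2) + Real.log (π^2/6))) := by
    rw [Real.log_div (by positivity) (by positivity), Real.log_mul hApos.ne' hBpos.ne',
      Real.log_div (by positivity) (by positivity), Real.log_mul (by positivity) hlX.ne',
      Real.log_exp, Real.log_mul hs2.ne' hpi.ne']
  rw [hlog]
  simp only [Function.comp]
  rw [hlls]
  linarith
end

section
/- For positive integers u, v and Re(s) > 1, ∑_{m≥1} d(mu)d(mv)/m^s = (ζ(s)⁴/ζ(2s)) d(u) d(v) B_{u,v}(s), where B_{u,v}(s) = ∏_{p^α||u, p^β||v} (1 - ((3αβ+2α+2β)p^s - αβ)/((α+1)(β+1)p^s(p^s+1))). -/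
open Finset

lemma dcl_submul (m n : ℕ) : (m * n).divisors.card ≤ m.divisors.card * n.divisors.card := by
  rw [Nat.divisors_mul]; exact Finset.card_mul_le

lemma dcl_summable_d {s : ℂ} (hs : 1 < s.re) :
    LSeriesSummable (fun m => (m.divisors.card : ℂ)) s := by
  have h := (LSeriesSummable_one_iff.mpr hs).convolution (LSeriesSummable_one_iff.mpr hs)
  refine (LSeriesSummable_congr s fun {n} hn => ?_).mp h
  simp [LSeries.convolution_def]
  rw [← Nat.map_div_right_divisors, Finset.card_map]

lemma dcl_summable_d2 {s : ℂ} (hs : 1 < s.re) :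
    LSeriesSummable (fun m => (m.divisors.card : ℂ) ^ 2) s := by
  have h := (dcl_summable_d hs).convolution (dcl_summable_d hs)
  refine Summable.of_norm_bounded h.norm fun n => LSeries.norm_term_le s ?_
  rw [LSeries.convolution_def]
  have h1 : n.divisors.card ^ 2 ≤
      ∑ p ∈ n.divisorsAntidiagonal, p.1.divisors.card * p.2.divisors.card := by
    calc n.divisors.card ^ 2 = ∑ p ∈ n.divisorsAntidiagonal, n.divisors.card := by
          rw [Finset.sum_const, ← Nat.map_div_right_divisors, Finset.card_map, smul_eq_mul, sq]
      _ ≤ _ := by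
          refine Finset.sum_le_sum fun p hp => ?_
          rw [← (Nat.mem_divisorsAntidiagonal.mp hp).1]
          exact dcl_submul _ _
  have h2 : (∑ p ∈ n.divisorsAntidiagonal, (p.1.divisors.card : ℂ) * (p.2.divisors.card : ℂ)) =
     ((∑ p ∈ n.divisorsAntidiagonal, p.1.divisors.card * p.2.divisors.card : ℕ) : ℂ) := by
    push_cast; rfl
  beta_reduce
  rw [h2, ← Nat.cast_pow, Complex.norm_natCast, Complex.norm_natCast]
  exact_mod_cast h1

lemma dcl_summable (u v : ℕ) {s : ℂ} (hs : 1 < s.re) :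
    LSeriesSummable
      (fun m => (((m * u).divisors.card * (m * v).divisors.card : ℕ) : ℂ)) s := by
  have h := (dcl_summable_d2 hs).smul ((u.divisors.card * v.divisors.card : ℕ) : ℂ)
  refine Summable.of_norm_bounded h.norm fun n => LSeries.norm_term_le s ?_
  simp only [Pi.smul_apply, smul_eq_mul]
  rw [← Nat.cast_pow, ← Nat.cast_mul, Complex.norm_natCast, Complex.norm_natCast]
  have := Nat.mul_le_mul (dcl_submul n u) (dcl_submul n v)
  norm_cast
  refine this.trans (le_of_eq (by ring))

lemma dcl_mul {m n : ℕ} (u : ℕ) (h : m.Coprime n) :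
    (m * n * u).divisors.card * u.divisors.card =
      (m * u).divisors.card * (n * u).divisors.card := by
  have := (ArithmeticFunction.isMultiplicative_sigma (k := 0)).lcm_apply_mul_gcd_apply
    (x := m * u) (y := n * u)
  rw [Nat.lcm_mul_right, Nat.gcd_mul_right, h.lcm_eq_mul, h.gcd_eq_one, one_mul] at this
  simpa only [ArithmeticFunction.sigma_zero_apply] using this

lemma dcl_local {p : ℕ} (hp : p.Prime) {u : ℕ} (hu : u ≠ 0) (k : ℕ) :
    (p ^ k * u).divisors.card * (u.factorization p + 1) =
      u.divisors.card * (k + u.factorization p + 1) := by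
  have hc : ∀ j, (p ^ j).Coprime (u / p ^ u.factorization p) := fun j =>
    (Nat.coprime_ordCompl hp hu).pow_left j
  have e := Nat.ordProj_mul_ordCompl_eq_self u p
  set a := u.factorization p
  set w := u / p ^ a
  have hd : ∀ j, (p ^ j * w).divisors.card = (j + 1) * w.divisors.card := fun j => by
    rw [(hc j).card_divisors_mul, Nat.divisors_prime_pow hp]; simp
  have h1 : p ^ k * u = p ^ (k + a) * w := by rw [← e]; ring
  have h2 : u.divisors.card = (a + 1) * w.divisors.card := by rw [← hd, e]
  rw [h1, h2, hd]; ring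

lemma dcl_sum {x : ℂ} (hx : ‖x‖ < 1) (a b : ℂ) :
    HasSum (fun k : ℕ => (k + a + 1) * (k + b + 1) * x ^ k)
      (((1 + x) * ((a + 1) * (b + 1)) - (3 * a * b + 2 * a + 2 * b) * x + a * b * x ^ 2)
        / (1 - x) ^ 3) := by
  have h0 := hasSum_choose_mul_geometric_of_norm_lt_one 0 hx
  have h1 := hasSum_choose_mul_geometric_of_norm_lt_one 1 hx
  have h2 := hasSum_choose_mul_geometric_of_norm_lt_one 2 hx
  have hne : 1 - x ≠ 0 := by
    intro h
    rw [← sub_eq_zero.mp h] at hx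
    simp at hx
  convert! ((h2.mul_left 2).add (h1.mul_left (a + b - 1))).add (h0.mul_left (a * b)) using 1
  · funext k
    have : ((Nat.choose (k + 2) 2 : ℕ) : ℂ) = (k + 2) * (k + 1) / 2 := by
      rw [Nat.cast_choose_two]; push_cast; ring
    rw [this]
    simp
    ring
  · field_simp
    ring


/-- For positive integers `u, v` and `Re s > 1`,
`∑_{m ≥ 1} d(mu) d(mv)/m^s = (ζ(s)⁴/ζ(2s)) d(u) d(v) B_{u,v}(s)`, where
`B_{u,v}(s) = ∏_{p^α ∥ u, p^β ∥ v}
  (1 - ((3αβ+2α+2β) p^s - αβ)/((α+1)(β+1) p^s (p^s+1)))`. -/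
theorem divisor_correlation_lseries (u v : ℕ) (hu : 1 ≤ u) (hv : 1 ≤ v)
    (s : ℂ) (hs : 1 < s.re) :
    LSeries (fun m => (((m * u).divisors.card * (m * v).divisors.card : ℕ) : ℂ)) s =
      riemannZeta s ^ 4 / riemannZeta (2 * s) *
        (u.divisors.card : ℂ) * (v.divisors.card : ℂ) *
        ∏ p ∈ (u * v).primeFactors,
          (1 - ((3 * (u.factorization p : ℂ) * (v.factorization p : ℂ)
                  + 2 * (u.factorization p : ℂ) + 2 * (v.factorization p : ℂ))
                    * (p : ℂ) ^ s
                - (u.factorization p : ℂ) * (v.factorization p : ℂ)) /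
              (((u.factorization p : ℂ) + 1) * ((v.factorization p : ℂ) + 1)
                * (p : ℂ) ^ s * ((p : ℂ) ^ s + 1))) := by
  set du : ℂ := (u.divisors.card : ℂ) with hdu
  set dv : ℂ := (v.divisors.card : ℂ) with hdv
  have hu0 : u ≠ 0 := by omega
  have hv0 : v ≠ 0 := by omega
  have hdu0 : du ≠ 0 := by simp [hdu, hu0]
  have hdv0 : dv ≠ 0 := by simp [hdv, hv0]
  set B : ℕ → ℂ := fun p => (1 - ((3 * (u.factorization p : ℂ) * (v.factorization p : ℂ)
                  + 2 * (u.factorization p : ℂ) + 2 * (v.factorization p : ℂ))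
                    * (p : ℂ) ^ s
                - (u.factorization p : ℂ) * (v.factorization p : ℂ)) /
              (((u.factorization p : ℂ) + 1) * ((v.factorization p : ℂ) + 1)
                * (p : ℂ) ^ s * ((p : ℂ) ^ s + 1))) with hB
  set g : ℕ → ℂ := fun m => (((m * u).divisors.card * (m * v).divisors.card : ℕ) : ℂ) with hg
  have hsum : LSeriesSummable g s := dcl_summable u v hs
  set f : ℕ → ℂ := fun n => LSeries.term g s n / (du * dv) with hf
  have hf0 : f 0 = 0 := by simp [hf]
  have hf1 : f 1 = 1 := by
    simp [hf, hg, LSeries.term]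
    field_simp
    simp [hdu, hdv]
  have hfmul : ∀ {m n : ℕ}, m.Coprime n → f (m * n) = f m * f n := by
    intro m n hmn
    rcases eq_or_ne m 0 with rfl | hm
    · simp [hf0]
    rcases eq_or_ne n 0 with rfl | hn
    · simp [hf0]
    simp only [hf, LSeries.term_of_ne_zero hm, LSeries.term_of_ne_zero hn,
      LSeries.term_of_ne_zero (mul_ne_zero hm hn), hg]
    have e1 : (((m * n * u).divisors.card : ℂ)) * du =
      (m * u).divisors.card * (n * u).divisors.card := by
        rw [hdu]; exact_mod_cast dcl_mul u hmn
    have e2 : (((m * n * v).divisors.card : ℂ)) * dv =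
      (m * v).divisors.card * (n * v).divisors.card := by
        rw [hdv]; exact_mod_cast dcl_mul v hmn
    rw [Nat.cast_mul m n, Complex.natCast_mul_natCast_cpow]
    push_cast
    have hms : (m : ℂ) ^ s ≠ 0 := by simp [Complex.cpow_eq_zero_iff, hm]
    have hns : (n : ℂ) ^ s ≠ 0 := by simp [Complex.cpow_eq_zero_iff, hn]
    field_simp
    linear_combination ((m * n * v).divisors.card : ℂ) * dv * e1 +
      ((m * u).divisors.card : ℂ) * (n * u).divisors.card * e2
  have hfs : Summable f := hsum.div_const _
  have hP := EulerProduct.eulerProduct_hasProd hf1 hfmul hfs.norm hf0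
  have hZ := riemannZeta_eulerProduct_hasProd hs
  have h2s : 1 < (2 * s).re := by simp; linarith
  have hZ2 := riemannZeta_eulerProduct_hasProd h2s
  have hBP : HasProd (fun p : Nat.Primes => B p) (∏ p ∈ (u * v).primeFactors, B p) := by
    rw [← Finset.prod_subtype_of_mem B (p := Nat.Prime)
      (fun x hx => Nat.prime_of_mem_primeFactors hx)]
    refine hasProd_prod_of_ne_finset_one fun p hp => ?_
    have hp' : ¬ (p : ℕ) ∣ u * v := by
      intro h
      exact hp (Finset.mem_subtype.mpr (Nat.mem_primeFactors.mpr ⟨p.2, h, mul_ne_zero hu0 hv0⟩))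
    have hpu : u.factorization p = 0 :=
      Nat.factorization_eq_zero_of_not_dvd fun h => hp' (h.mul_right _)
    have hpv : v.factorization p = 0 :=
      Nat.factorization_eq_zero_of_not_dvd fun h => hp' (h.mul_left _)
    simp [hB, hpu, hpv]
  have key : ∀ p : Nat.Primes, (∑' e, f ((p : ℕ) ^ e)) * (1 - (p : ℂ) ^ (-(2 * s)))⁻¹ =
      (1 - (p : ℂ) ^ (-s))⁻¹ * (1 - (p : ℂ) ^ (-s))⁻¹ *
      ((1 - (p : ℂ) ^ (-s))⁻¹ * (1 - (p : ℂ) ^ (-s))⁻¹) * B p := by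
    rintro ⟨p, hp⟩
    simp only
    have hpn : ‖(p : ℂ) ^ (-s)‖ < 1 := by
      rw [Complex.norm_natCast_cpow_of_pos hp.pos]
      apply Real.rpow_lt_one_of_one_lt_of_neg (mod_cast hp.one_lt)
      simp; linarith
    have hp0 : (p : ℂ) ≠ 0 := by exact_mod_cast hp.ne_zero
    have hps : (p : ℂ) ^ s = ((p : ℂ) ^ (-s))⁻¹ := by rw [Complex.cpow_neg, inv_inv]
    have hp2 : (p : ℂ) ^ (-(2 * s)) = ((p : ℂ) ^ (-s)) ^ 2 := by
      rw [← Complex.cpow_nat_mul]; congr 1; push_cast; ring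
    have hx0 : (p : ℂ) ^ (-s) ≠ 0 := by simp [Complex.cpow_eq_zero_iff, hp.ne_zero]
    have hterm : ∀ k : ℕ, f (p ^ k) =
        ((k + (u.factorization p : ℂ) + 1) * (k + (v.factorization p : ℂ) + 1)
          * ((p : ℂ) ^ (-s)) ^ k) /
          (((u.factorization p : ℂ) + 1) * ((v.factorization p : ℂ) + 1)) := by
      intro k
      have e1 : (((p ^ k * u).divisors.card : ℂ)) * (u.factorization p + 1) =
        du * (k + u.factorization p + 1) := by
        rw [hdu]; exact_mod_cast dcl_local hp hu0 k
      have e2 : (((p ^ k * v).divisors.card : ℂ)) * (v.factorization p + 1) =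
        dv * (k + v.factorization p + 1) := by
        rw [hdv]; exact_mod_cast dcl_local hp hv0 k
      have hpk : ((p ^ k : ℕ) : ℂ) ^ s = (((p : ℂ) ^ (-s)) ^ k)⁻¹ := by
        rw [Nat.cast_pow, ← Complex.natCast_cpow_natCast_mul, ← inv_pow, ← hps,
          Complex.cpow_nat_mul]
      have ha : (u.factorization p : ℂ) + 1 ≠ 0 := Nat.cast_add_one_ne_zero _
      have hb : (v.factorization p : ℂ) + 1 ≠ 0 := Nat.cast_add_one_ne_zero _
      simp only [hf, hg]
      rw [LSeries.term_of_ne_zero (pow_ne_zero k hp.ne_zero), hpk]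
      generalize (u.factorization p : ℂ) = a at *
      generalize (v.factorization p : ℂ) = b at *
      push_cast
      field_simp
      linear_combination ((p ^ k * v).divisors.card : ℂ) * (b + 1) * e1 +
        du * (k + a + 1) * e2
    simp only [hterm]
    rw [tsum_div_const, (dcl_sum hpn _ _).tsum_eq]
    simp only [hB]
    rw [hps, hp2]
    have ha : (u.factorization p : ℂ) + 1 ≠ 0 := Nat.cast_add_one_ne_zero _
    have hb : (v.factorization p : ℂ) + 1 ≠ 0 := Nat.cast_add_one_ne_zero _
    generalize (u.factorization p : ℂ) = a at *
    generalize (v.factorization p : ℂ) = b at *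
    generalize (p : ℂ) ^ (-s) = x at *
    have h1 : 1 - x ≠ 0 := by
      intro h
      rw [← sub_eq_zero.mp h] at hpn
      simp at hpn
    have h2 : 1 + x ≠ 0 := by
      intro h
      rw [show x = -1 by linear_combination h] at hpn
      simp at hpn
    have h3 : 1 - x ^ 2 = (1 - x) * (1 + x) := by ring
    have h4 : x⁻¹ + 1 = (1 + x) / x := by field_simp
    rw [h3, h4]
    field_simp
    ring
  have hL := hP.mul hZ2
  have hR := ((hZ.mul hZ).mul (hZ.mul hZ)).mul hBP
  have heq := HasProd.unique hL (by simpa only [key] using hR)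
  have hz := riemannZeta_ne_zero_of_one_lt_re h2s
  have hLS : ∑' n, f n = LSeries g s / (du * dv) := by
    rw [LSeries, ← tsum_div_const]
  rw [hLS] at heq
  field_simp at heq ⊢
  linear_combination heq
end
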